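/- Up to rotation, there are exactly 107 minimal relations of weight at most 12; that is, the quotient of the set of minimal relations of weight ≤ 12 by the equivalence 'a ∼ a′ iff a′ is a rotation of a' has exactly 107 elements. -/

import Mathlib

noncomputable section

/-- A relation: a finitely supported function from roots of unity to `ℕ`,
not identically zero, whose weighted sum of roots of unity is zero. -/
structure ZeroRelation where
  coeff : ℂ →₀ ℕ
  mem_rootsOfUnity : ∀ z ∈ coeff.support, ∃ m : ℕ, 0 < m ∧ z ^ m = 1
  ne_zero : coeff ≠ 0
  sum_zero : (coeff.sum fun z c => (c : ℂ) * z) = 0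

/-- The weight of a relation: the sum of its coefficients. -/
def ZeroRelation.weight (a : ZeroRelation) : ℕ := a.coeff.sum fun _ c => c

/-- A relation is minimal if it has no nontrivial subrelation. -/
def ZeroRelation.IsMinimal (a : ZeroRelation) : Prop :=
  ∀ b : ℂ →₀ ℕ, (∀ z, b z ≤ a.coeff z) →
    (b.sum fun z c => (c : ℂ) * z) = 0 → b = 0 ∨ b = a.coeff

/-- `b` is a rotation of `a`: multiplying every element of the support of `a`
by a fixed root of unity `lam` yields `b`. -/
def ZeroRelation.IsRotation (a b : ZeroRelation) : Prop :=
  ∃ lam : ℂ, (∃ m : ℕ, 0 < m ∧ lam ^ m = 1) ∧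
    Finsupp.mapDomain (fun z => lam * z) a.coeff = b.coeff

/-- A multiset of complex numbers with no nonempty sub-multiset of sum zero. -/
def ZeroSumFree (T : Multiset ℂ) : Prop := ∀ t ≤ T, t.sum = 0 → t = 0

/-- A nonempty multiset of complex numbers with sum zero, minimal for inclusion. -/
def MinimalZeroSum (s : Multiset ℂ) : Prop :=
  s ≠ 0 ∧ s.sum = 0 ∧ ∀ t ≤ s, t.sum = 0 → t = 0 ∨ t = s

/-- The union of the multisets `A j`, each scaled by `R j`. -/
def glue {ι : Type*} [Fintype ι] (R : ι → ℂ) (A : ι → Multiset ℂ) : Multiset ℂ :=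
  ∑ j, (A j).map (R j * ·)

theorem sum_map_mul (c : ℂ) (s : Multiset ℂ) : (s.map (c * ·)).sum = c * s.sum := by
  simpa using Multiset.sum_map_mul_left (a := c) (s := s) (f := id)

section glue

variable {ι : Type*} [Fintype ι] {R : ι → ℂ} {A B : ι → Multiset ℂ}

theorem sum_glue : (glue R A).sum = ∑ j, R j * (A j).sum := by
  simp [glue, Multiset.sum_sum, sum_map_mul]

theorem card_glue : (glue R A).card = ∑ j, (A j).card := by
  simp [glue, Multiset.card_sum]

theorem glue_mono (h : ∀ j, A j ≤ B j) : glue R A ≤ glue R B :=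
  Finset.sum_le_sum fun j _ => Multiset.map_le_map (h j)

theorem map_le_glue (j : ι) : (A j).map (R j * ·) ≤ glue R A :=
  Finset.single_le_sum (f := fun j => (A j).map (R j * ·)) (fun _ _ => Multiset.zero_le _)
    (Finset.mem_univ j)

theorem mem_glue {z : ℂ} : z ∈ glue R A ↔ ∃ j, ∃ η ∈ A j, R j * η = z := by
  simp [glue, Multiset.mem_sum]

theorem map_mul_glue (c : ℂ) : (glue R A).map (c * ·) = glue (fun j => c * R j) A := by
  have := map_sum (Multiset.mapAddMonoidHom (c * ·)) (fun j => (A j).map (R j * ·)) Finset.univ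
  simp only [Multiset.coe_mapAddMonoidHom] at this
  simp [glue, this, mul_assoc]

theorem map_mul_glue' (c : ℂ) :
    (glue R A).map (c * ·) = glue R (fun j => (A j).map (c * ·)) := by
  rw [map_mul_glue]
  simp only [glue, Multiset.map_map, Function.comp_def, mul_assoc, mul_left_comm c]

theorem glue_add (A B : ι → Multiset ℂ) : glue R (A + B) = glue R A + glue R B := by
  simp [glue, Finset.sum_add_distrib]

theorem glue_single [DecidableEq ι] (j : ι) (η : ℂ) :
    glue R (Pi.single j {η}) = {R j * η} := by
  rw [glue, Finset.sum_eq_single j]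
  · simp
  · intro b _ hb
    simp [Pi.single_eq_of_ne hb]
  · simp

/-- A multiset all of whose elements are of the form `R j * η` is glued from multisets of such
`η`. -/
theorem exists_glue {P : ℂ → Prop} (R : ι → ℂ) (s : Multiset ℂ)
    (h : ∀ z ∈ s, ∃ j η, P η ∧ z = R j * η) :
    ∃ A : ι → Multiset ℂ, (∀ j, ∀ η ∈ A j, P η) ∧ s = glue R A := by
  classical
  induction s using Multiset.induction with
  | empty => exact ⟨0, by simp, by simp [glue]⟩
  | cons a s ih =>
    obtain ⟨A, hA, rfl⟩ := ih fun z hz => h z (Multiset.mem_cons_of_mem hz)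
    obtain ⟨j, η, hη, rfl⟩ := h a (Multiset.mem_cons_self _ _)
    refine ⟨Pi.single j {η} + A, ?_, ?_⟩
    · intro i x hx
      rw [Pi.add_apply, Multiset.mem_add] at hx
      rcases hx with hx | hx
      · by_cases hij : i = j
        · subst hij
          simp at hx
          exact hx ▸ hη
        · simp [Pi.single_eq_of_ne hij] at hx
      · exact hA i x hx
    · rw [glue_add, glue_single, Multiset.singleton_add]

end glue

section scaling

variable {c : ℂ}

theorem map_mul_map_mul {c d : ℂ} (h : d * c = 1) (s : Multiset ℂ) :
    (s.map (c * ·)).map (d * ·) = s := by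
  simp [Multiset.map_map, ← mul_assoc, h]

theorem MinimalZeroSum.map_mul {s : Multiset ℂ} (hs : MinimalZeroSum s) (hc : c ≠ 0) :
    MinimalZeroSum (s.map (c * ·)) := by
  obtain ⟨h0, h1, h2⟩ := hs
  refine ⟨by simpa using h0, by simp [sum_map_mul, h1], fun t ht hts => ?_⟩
  have h3 := Multiset.map_le_map (f := (c⁻¹ * ·)) ht
  rw [map_mul_map_mul (inv_mul_cancel₀ hc)] at h3
  rcases h2 _ h3 (by simp [sum_map_mul, hts]) with h | h
  · left
    simpa using h
  · right
    rw [← h, map_mul_map_mul (mul_inv_cancel₀ hc)]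

theorem ZeroSumFree.map_mul {s : Multiset ℂ} (hs : ZeroSumFree s) (hc : c ≠ 0) :
    ZeroSumFree (s.map (c * ·)) := by
  intro t ht hts
  have h3 := Multiset.map_le_map (f := (c⁻¹ * ·)) ht
  rw [map_mul_map_mul (inv_mul_cancel₀ hc)] at h3
  simpa using hs _ h3 (by simp [sum_map_mul, hts])

end scaling

/-- Adjoining `-1` to a zero-sum-free multiset of sum `1` gives a minimal zero-sum multiset. -/
theorem ZeroSumFree.minimalZeroSum_cons {T : Multiset ℂ} (h : ZeroSumFree T) (h1 : T.sum = 1) :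
    MinimalZeroSum ((-1) ::ₘ T) := by
  classical
  refine ⟨Multiset.cons_ne_zero, by simp [h1], fun t ht hts => ?_⟩
  by_cases hm : (-1 : ℂ) ∈ t
  · right
    obtain ⟨t, rfl⟩ := Multiset.exists_cons_of_mem hm
    rw [Multiset.cons_le_cons_iff] at ht
    obtain ⟨u, rfl⟩ := Multiset.le_iff_exists_add.1 ht
    have ht1 : t.sum = 1 := by
      rw [Multiset.sum_cons] at hts
      linear_combination hts
    have : u = 0 := h u (Multiset.le_add_left _ _) (by simpa [ht1] using h1)
    simp [this]
  · left
    exact h t ((Multiset.le_cons_of_notMem hm).1 ht) hts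

section classes

variable {ι : Type*} [Fintype ι] {R : ι → ℂ} {A : ι → Multiset ℂ}

/-- If all scaled classes of a minimal zero-sum multiset have sum zero, there is only one. -/
theorem MinimalZeroSum.exists_eq_map (h : MinimalZeroSum (glue R A))
    (h0 : ∀ j, R j * (A j).sum = 0) : ∃ j, glue R A = (A j).map (R j * ·) := by
  have : ∃ j, A j ≠ 0 := by
    by_contra! hA
    exact h.1 (by simp [glue, hA])
  obtain ⟨j, hj⟩ := this
  refine ⟨j, ?_⟩
  rcases h.2.2 _ (map_le_glue j) (by rw [sum_map_mul, h0]) with h' | h'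
  · exact absurd (by simpa using h') hj
  · exact h'.symm

theorem MinimalZeroSum.zeroSumFree {α : ℂ} [Nontrivial ι] (h : MinimalZeroSum (glue R A))
    (hR : ∀ j, R j ≠ 0) (hα : α ≠ 0) (hA : ∀ j, (A j).sum = α) (i : ι) : ZeroSumFree (A i) := by
  intro t ht hts
  have h1 := Multiset.map_le_map (f := (R i * ·)) ht
  rcases h.2.2 _ (h1.trans (map_le_glue i)) (by rw [sum_map_mul, hts, mul_zero]) with h2 | h2
  · simpa using h2
  · exfalso
    have h3 : glue R A = (A i).map (R i * ·) :=
      le_antisymm (h2 ▸ h1) (map_le_glue i)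
    have h4 := h.2.1
    rw [h3, sum_map_mul, hA] at h4
    exact mul_ne_zero (hR i) hα h4

/-- A minimal zero-sum multiset has no proper choice of nonempty subclasses of common sum. -/
theorem MinimalZeroSum.eq_of_common_sum {β : ℂ} (h : MinimalZeroSum (glue R A))
    (hR : ∑ j, R j = 0) {B : ι → Multiset ℂ} (hB : ∀ j, B j ≤ A j) (hs : ∀ j, (B j).sum = β)
    (hne : ∃ j, B j ≠ 0) : B = A := by
  have h1 : glue R B = glue R A := by
    rcases h.2.2 _ (glue_mono hB) (by simp [sum_glue, hs, ← Finset.sum_mul, hR]) with h2 | h2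
    · obtain ⟨j, hj⟩ := hne
      have := map_le_glue (R := R) (A := B) j
      rw [h2] at this
      exact absurd (by simpa using this) hj
    · exact h2
  have h2 := congrArg Multiset.card h1
  rw [card_glue, card_glue, Finset.sum_eq_sum_iff_of_le
    (fun j _ => Multiset.card_le_card (hB j))] at h2
  funext j
  exact Multiset.eq_of_le_of_card_le (hB j) (h2 j (Finset.mem_univ j)).ge

end classes

/-- The sum of a multiset of `N`-th roots of unity vanishes together with the sum of its image
under raising to a power prime to `N`. -/
theorem sum_map_pow_eq_zero {N : ℕ} (hN : 0 < N) {s : Multiset ℂ} (hs : ∀ z ∈ s, z ^ N = 1)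
    (h0 : s.sum = 0) {k : ℕ} (hk : k.Coprime N) : (s.map (· ^ k)).sum = 0 := by
  have : NeZero N := ⟨hN.ne'⟩
  obtain ⟨ω, hω⟩ : ∃ ω : ℂ, IsPrimitiveRoot ω N := ⟨_, Complex.isPrimitiveRoot_exp N hN.ne'⟩
  obtain ⟨t, rfl⟩ : ∃ t : Multiset ℕ, s = t.map (ω ^ ·) := by
    clear h0
    induction s using Multiset.induction with
    | empty => exact ⟨0, rfl⟩
    | cons a s ih =>
      obtain ⟨t, rfl⟩ := ih fun z hz => hs z (Multiset.mem_cons_of_mem hz)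
      obtain ⟨i, -, rfl⟩ := hω.eq_pow_of_pow_eq_one (hs a (Multiset.mem_cons_self _ _))
      exact ⟨i ::ₘ t, by simp⟩
  have key (z : ℂ) : Polynomial.aeval z ((t.map fun i => (Polynomial.X : Polynomial ℤ) ^ i).sum)
      = (t.map (z ^ ·)).sum := by
    rw [map_multiset_sum, Multiset.map_map]
    simp
  have h1 := minpoly.isIntegrallyClosed_dvd (hω.isIntegral hN) ((key ω).trans h0)
  rw [hω.minpoly_eq_pow_coprime hk] at h1
  obtain ⟨q, hq⟩ := h1
  have h2 := key (ω ^ k)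
  rw [hq, map_mul, minpoly.aeval, zero_mul] at h2
  rw [Multiset.map_map, h2]
  simp [← pow_mul, mul_comm]

section fourier

variable {p : ℕ} [NeZero p]

theorem sum_stdAddChar_mul_sum (β : ZMod p → ℂ) (i : ZMod p) :
    ∑ t, ZMod.stdAddChar (-(t * i)) * ∑ j, ZMod.stdAddChar (t * j) * β j = p * β i := by
  simp_rw [Finset.mul_sum]
  rw [Finset.sum_comm]
  have h (j t : ZMod p) : ZMod.stdAddChar (-(t * i)) * (ZMod.stdAddChar (t * j) * β j)
      = ZMod.stdAddChar (t * (j - i)) * β j := by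
    rw [← mul_assoc, ← AddChar.map_add_eq_mul]
    ring_nf
  simp_rw [h, ← Finset.sum_mul, AddChar.sum_mulShift _ (ZMod.isPrimitive_stdAddChar p)]
  rw [Finset.sum_eq_single i]
  · simp
  · intro j _ hj
    simp [sub_eq_zero, hj]
  · simp

theorem eq_zero_of_forall_sum_stdAddChar_mul {β : ZMod p → ℂ}
    (h : ∀ t, ∑ j, ZMod.stdAddChar (t * j) * β j = 0) (i : ZMod p) : β i = 0 := by
  have := sum_stdAddChar_mul_sum β i
  simp only [h, mul_zero, Finset.sum_const_zero] at this
  exact (mul_eq_zero.1 this.symm).resolve_left (Nat.cast_ne_zero.2 (NeZero.ne p))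

theorem eq_of_forall_ne_zero_sum_stdAddChar_mul {β : ZMod p → ℂ}
    (h : ∀ t ≠ 0, ∑ j, ZMod.stdAddChar (t * j) * β j = 0) (i j : ZMod p) : β i = β j := by
  have key (i : ZMod p) : p * β i = ∑ j, β j := by
    rw [← sum_stdAddChar_mul_sum, Finset.sum_eq_single 0]
    · simp
    · intro t _ ht
      rw [h t ht, mul_zero]
    · simp
  exact mul_left_cancel₀ (Nat.cast_ne_zero.2 (NeZero.ne p)) ((key i).trans (key j).symm)

theorem sum_stdAddChar (hp : p.Prime) : ∑ j : ZMod p, (ZMod.stdAddChar j : ℂ) = 0 := by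
  have : Fact p.Prime := ⟨hp⟩
  simpa [one_ne_zero] using AddChar.sum_mulShift (1 : ZMod p) (ZMod.isPrimitive_stdAddChar p)

theorem stdAddChar_pow (k : ℕ) (j : ZMod p) :
    ZMod.stdAddChar j ^ k = ZMod.stdAddChar ((k : ZMod p) * j) := by
  rw [← AddChar.map_nsmul_eq_pow, nsmul_eq_mul]

theorem stdAddChar_pow_self (j : ZMod p) : ZMod.stdAddChar j ^ p = 1 := by
  simp [stdAddChar_pow]

theorem stdAddChar_ne_zero (j : ZMod p) : ZMod.stdAddChar j ≠ 0 :=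
  fun h => by simpa [h, NeZero.ne p] using stdAddChar_pow_self j

theorem isPrimitiveRoot_stdAddChar_one : IsPrimitiveRoot (ZMod.stdAddChar (1 : ZMod p)) p := by
  have := Complex.isPrimitiveRoot_exp p (NeZero.ne p)
  have h := ZMod.stdAddChar_coe (N := p) 1
  simp only [Int.cast_one, mul_one] at h
  rwa [h]

theorem exists_eq_stdAddChar {z : ℂ} (hz : z ^ p = 1) : ∃ j : ZMod p, z = ZMod.stdAddChar j := by
  obtain ⟨i, -, rfl⟩ := isPrimitiveRoot_stdAddChar_one.eq_pow_of_pow_eq_one hz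
  exact ⟨i, by simp [stdAddChar_pow]⟩

end fourier

theorem pow_eq_self_of_modEq {η : ℂ} {M k : ℕ} (h : k ≡ 1 [MOD M]) (hη : η ^ M = 1) :
    η ^ k = η := by
  rw [pow_eq_pow_of_modEq h hη, pow_one]

theorem map_pow_glue {ι : Type*} [Fintype ι] {R : ι → ℂ} {A : ι → Multiset ℂ} {k : ℕ}
    (h : ∀ j, ∀ η ∈ A j, η ^ k = η) :
    (glue R A).map (· ^ k) = glue (fun j => R j ^ k) A := by
  have := map_sum (Multiset.mapAddMonoidHom (· ^ k)) (fun j => (A j).map (R j * ·)) Finset.univ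
  simp only [Multiset.coe_mapAddMonoidHom] at this
  simp only [glue, this, Multiset.map_map]
  refine Finset.sum_congr rfl fun j _ => Multiset.map_congr rfl fun η hη => ?_
  simp [mul_pow, h j η hη]

section coprime

variable {p M : ℕ} [NeZero p]

/-- The union of the multisets `A j`, each scaled by a `p`-th root of unity. -/
abbrev cglue (A : ZMod p → Multiset ℂ) : Multiset ℂ := glue (fun j => ZMod.stdAddChar j) A

theorem exists_stdAddChar_mul (hpM : p.Coprime M) {z : ℂ} (hz : z ^ (p * M) = 1) :
    ∃ (j : ZMod p) (η : ℂ), η ^ M = 1 ∧ z = ZMod.stdAddChar j * η := by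
  obtain ⟨k, hk1, hk2⟩ := Nat.chineseRemainder hpM 1 0
  obtain ⟨l, hl1, hl2⟩ := Nat.chineseRemainder hpM 0 1
  have h : k + l ≡ 1 [MOD p * M] :=
    (Nat.modEq_and_modEq_iff_modEq_mul hpM).1 ⟨hk1.add hl1, hk2.add hl2⟩
  obtain ⟨j, hj⟩ : ∃ j : ZMod p, z ^ k = ZMod.stdAddChar j := by
    refine exists_eq_stdAddChar ?_
    obtain ⟨q, rfl⟩ := (Nat.modEq_zero_iff_dvd).1 hk2
    rw [← pow_mul, show M * q * p = p * M * q by ring, pow_mul, hz, one_pow]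
  refine ⟨j, z ^ l, ?_, ?_⟩
  · obtain ⟨q, rfl⟩ := (Nat.modEq_zero_iff_dvd).1 hl1
    rw [← pow_mul, show p * q * M = p * M * q by ring, pow_mul, hz, one_pow]
  · rw [← hj, ← pow_add, pow_eq_self_of_modEq h hz]

theorem exists_cglue (hpM : p.Coprime M) {s : Multiset ℂ} (hs : ∀ z ∈ s, z ^ (p * M) = 1) :
    ∃ A : ZMod p → Multiset ℂ, (∀ j, ∀ η ∈ A j, η ^ M = 1) ∧ s = cglue A :=
  exists_glue (P := fun η => η ^ M = 1) (fun j : ZMod p => ZMod.stdAddChar j) s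
    fun z hz => exists_stdAddChar_mul hpM (hs z hz)

theorem pow_eq_one_of_mem_cglue {A : ZMod p → Multiset ℂ} (hA : ∀ j, ∀ η ∈ A j, η ^ M = 1)
    {z : ℂ} (hz : z ∈ cglue A) : z ^ (p * M) = 1 := by
  obtain ⟨j, η, hη, rfl⟩ := mem_glue.1 hz
  rw [mul_pow, pow_mul, stdAddChar_pow_self, mul_comm p M, pow_mul, hA j η hη]
  simp

theorem stdAddChar_mul_inj (hpM : p.Coprime M) {i j : ZMod p} {η θ : ℂ} (hη : η ^ M = 1)
    (hθ : θ ^ M = 1) (h : ZMod.stdAddChar i * η = ZMod.stdAddChar j * θ) :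
    i = j ∧ η = θ := by
  obtain ⟨k, hk1, hk2⟩ := Nat.chineseRemainder hpM 1 0
  have hk (η : ℂ) (hη : η ^ M = 1) : η ^ k = 1 := by
    obtain ⟨q, rfl⟩ := (Nat.modEq_zero_iff_dvd).1 hk2
    rw [pow_mul, hη, one_pow]
  have h1 := congrArg (· ^ k) h
  simp only [mul_pow, hk η hη, hk θ hθ, mul_one] at h1
  rw [pow_eq_self_of_modEq hk1 (stdAddChar_pow_self _),
    pow_eq_self_of_modEq hk1 (stdAddChar_pow_self _)] at h1
  have hij := ZMod.injective_stdAddChar h1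
  subst hij
  exact ⟨rfl, mul_left_cancel₀ (stdAddChar_ne_zero _) h⟩

open Classical in
theorem count_cglue (hpM : p.Coprime M) {A : ZMod p → Multiset ℂ}
    (hA : ∀ j, ∀ η ∈ A j, η ^ M = 1) (i : ZMod p) {η : ℂ} (hη : η ^ M = 1) :
    (cglue A).count (ZMod.stdAddChar i * η) = (A i).count η := by
  rw [cglue, glue, Multiset.count_sum', Finset.sum_eq_single i]
  · exact Multiset.count_map_eq_count' _ _ (mul_right_injective₀ (stdAddChar_ne_zero i)) _
  · intro j _ hj
    rw [Multiset.count_eq_zero, Multiset.mem_map]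
    rintro ⟨θ, hθ, h⟩
    exact hj (stdAddChar_mul_inj hpM (hA j θ hθ) hη h).1
  · simp

theorem le_of_cglue_le (hpM : p.Coprime M) {A B : ZMod p → Multiset ℂ}
    (hA : ∀ j, ∀ η ∈ A j, η ^ M = 1) (hB : ∀ j, ∀ η ∈ B j, η ^ M = 1)
    (h : cglue A ≤ cglue B) (i : ZMod p) : A i ≤ B i := by
  classical
  rw [Multiset.le_iff_count] at h ⊢
  intro η
  by_cases hη : η ∈ A i
  · rw [← count_cglue hpM hA i (hA i η hη), ← count_cglue hpM hB i (hA i η hη)]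
    exact h _
  · rw [Multiset.count_eq_zero.2 hη]
    exact Nat.zero_le _

theorem eq_of_cglue_eq (hpM : p.Coprime M) {A B : ZMod p → Multiset ℂ}
    (hA : ∀ j, ∀ η ∈ A j, η ^ M = 1) (hB : ∀ j, ∀ η ∈ B j, η ^ M = 1)
    (h : cglue A = cglue B) : A = B :=
  funext fun i => le_antisymm (le_of_cglue_le hpM hA hB h.le i)
    (le_of_cglue_le hpM hB hA h.ge i)

/-- For `p` prime and prime to `M`, the only linear dependencies of the `p`-th roots of unity over
the `M`-th roots of unity are the constant ones. -/
theorem sum_eq_sum_of_cglue (hp : p.Prime) (hpM : p.Coprime M) (hM : 0 < M)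
    {A : ZMod p → Multiset ℂ} (hA : ∀ j, ∀ η ∈ A j, η ^ M = 1) (h0 : (cglue A).sum = 0)
    (i j : ZMod p) : (A i).sum = (A j).sum := by
  have : Fact p.Prime := ⟨hp⟩
  refine eq_of_forall_ne_zero_sum_stdAddChar_mul (β := fun j => (A j).sum) (fun t ht => ?_) i j
  obtain ⟨k, hk1, hk2⟩ := Nat.chineseRemainder hpM t.val 1
  have hkt : (k : ZMod p) = t := by
    rw [(ZMod.natCast_eq_natCast_iff _ _ _).2 hk1, ZMod.natCast_zmod_val]
  have hkp : k.Coprime p := by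
    rw [Nat.coprime_comm, hp.coprime_iff_not_dvd, ← ZMod.natCast_eq_zero_iff, hkt]
    exact ht
  have hkM : k.Coprime M := by
    rw [Nat.Coprime, hk2.gcd_eq, Nat.gcd_one_left]
  have h := sum_map_pow_eq_zero (Nat.mul_pos hp.pos hM) (fun z => pow_eq_one_of_mem_cglue hA) h0
    (hkp.mul_right hkM)
  rw [map_pow_glue fun j η hη => pow_eq_self_of_modEq hk2 (hA j η hη), sum_glue] at h
  simpa only [stdAddChar_pow, hkt] using h

end coprime

section reduction

variable {p M : ℕ} {s : Multiset ℂ}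

/-- A minimal zero-sum multiset of `pM`-th roots of unity, where `p ∣ M`, can be rotated to one of
`M`-th roots of unity. -/
theorem MinimalZeroSum.reduce_of_dvd (h : MinimalZeroSum s) (hp : p.Prime) (hM : 0 < M)
    (hpM : p ∣ M) (hs : ∀ z ∈ s, z ^ (p * M) = 1) :
    ∃ c : ℂ, c ^ (p * M) = 1 ∧ ∀ z ∈ s, (c * z) ^ M = 1 := by
  have : NeZero p := ⟨hp.ne_zero⟩
  have : NeZero (p * M) := ⟨(Nat.mul_pos hp.pos hM).ne'⟩
  set ω : ℂ := ZMod.stdAddChar (1 : ZMod (p * M)) with hωdef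
  have hω : IsPrimitiveRoot ω (p * M) := isPrimitiveRoot_stdAddChar_one
  have hωM : ω ^ M = ZMod.stdAddChar (1 : ZMod p) := by
    have h1 := ZMod.stdAddChar_coe (N := p * M) 1
    have h2 := ZMod.stdAddChar_coe (N := p) 1
    simp only [Int.cast_one] at h1 h2
    have hM' : (M : ℂ) ≠ 0 := Nat.cast_ne_zero.2 hM.ne'
    have hp' : (p : ℂ) ≠ 0 := Nat.cast_ne_zero.2 hp.ne_zero
    rw [hωdef, h1, h2, ← Complex.exp_nat_mul]
    congr 1
    push_cast
    field_simp
  obtain ⟨A, hA, rfl⟩ := exists_glue (P := fun η => η ^ M = 1)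
    (fun j : ZMod p => ω ^ j.val) s (by
      intro z hz
      obtain ⟨a, -, rfl⟩ := hω.eq_pow_of_pow_eq_one (hs z hz)
      refine ⟨a, ω ^ (p * (a / p)), ?_, ?_⟩
      · rw [← pow_mul, show p * (a / p) * M = p * M * (a / p) by ring, pow_mul, hω.pow_eq_one,
          one_pow]
      · rw [ZMod.val_natCast, ← pow_add, Nat.mod_add_div])
  have key (j : ZMod p) : ω ^ j.val * (A j).sum = 0 := by
    refine eq_zero_of_forall_sum_stdAddChar_mul
      (β := fun j : ZMod p => ω ^ j.val * (A j).sum) (fun t => ?_) j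
    have hk : 1 + t.val * M ≡ 1 [MOD M] := by simp [Nat.ModEq]
    have hkM : (1 + t.val * M).Coprime M := by
      rw [Nat.Coprime, hk.gcd_eq, Nat.gcd_one_left]
    have h1 := sum_map_pow_eq_zero (Nat.mul_pos hp.pos hM) hs h.2.1
      ((hkM.coprime_dvd_right hpM).mul_right hkM)
    rw [map_pow_glue fun j η hη => pow_eq_self_of_modEq hk (hA j η hη), sum_glue] at h1
    rw [← h1]
    refine Finset.sum_congr rfl fun j _ => ?_
    have : ZMod.stdAddChar (t * j) = (ω ^ M) ^ (t.val * j.val) := by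
      rw [hωM, stdAddChar_pow]
      simp
    rw [this]
    ring
  obtain ⟨j, hj⟩ := h.exists_eq_map key
  have hω0 : ω ^ j.val ≠ 0 := pow_ne_zero _ (stdAddChar_ne_zero _)
  refine ⟨(ω ^ j.val)⁻¹, ?_, fun z hz => ?_⟩
  · rw [inv_pow, ← pow_mul, mul_comm, pow_mul, hω.pow_eq_one, one_pow, inv_one]
  · rw [hj] at hz
    obtain ⟨η, hη, rfl⟩ := Multiset.mem_map.1 hz
    rw [inv_mul_cancel_left₀ hω0, hA j η hη]

/-- A minimal zero-sum multiset of `pM`-th roots of unity, where `p` is prime to `M`, can be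
rotated to one of `M`-th roots of unity unless its classes have a common nonzero sum. -/
theorem MinimalZeroSum.reduce_of_coprime [NeZero p] (h : MinimalZeroSum s) (hp : p.Prime)
    (hM : 0 < M) (hpM : p.Coprime M) (hs : ∀ z ∈ s, z ^ (p * M) = 1) :
    (∃ j : ZMod p, ∀ z ∈ s, (ZMod.stdAddChar j * z) ^ M = 1) ∨
    ∃ (A : ZMod p → Multiset ℂ) (α : ℂ), s = cglue A ∧ (∀ j, ∀ η ∈ A j, η ^ M = 1) ∧
      α ≠ 0 ∧ (∀ j, (A j).sum = α) ∧ (∀ j, ZeroSumFree (A j)) := by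
  obtain ⟨A, hA, rfl⟩ := exists_cglue hpM hs
  have hα := fun j => sum_eq_sum_of_cglue hp hpM hM hA h.2.1 j 0
  by_cases h0 : (A 0).sum = 0
  · left
    obtain ⟨j, hj⟩ := h.exists_eq_map fun j => by rw [hα, h0, mul_zero]
    refine ⟨-j, fun z hz => ?_⟩
    rw [cglue, hj] at hz
    obtain ⟨η, hη, rfl⟩ := Multiset.mem_map.1 hz
    rw [← mul_assoc, ← AddChar.map_add_eq_mul]
    simp [hA j η hη]
  · right
    have : Fact p.Prime := ⟨hp⟩
    exact ⟨A, (A 0).sum, rfl, hA, h0, hα, h.zeroSumFree (fun j => stdAddChar_ne_zero j) h0 hα⟩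

end reduction

section hexagon

/-- A primitive sixth root of unity. -/
def hexRoot : ℂ := ZMod.stdAddChar (1 : ZMod 6)

theorem hexRoot_isPrimitiveRoot : IsPrimitiveRoot hexRoot 6 := isPrimitiveRoot_stdAddChar_one

theorem hexRoot_sq : hexRoot ^ 2 = hexRoot - 1 := by
  have := hexRoot_isPrimitiveRoot.isRoot_cyclotomic (by norm_num)
  rw [Polynomial.cyclotomic_six] at this
  simp [Polynomial.IsRoot] at this
  linear_combination this

theorem hexRoot_pow_three : hexRoot ^ 3 = -1 := by
  linear_combination (hexRoot + 1) * hexRoot_sq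

theorem hexRoot_pow_four : hexRoot ^ 4 = -hexRoot := by
  linear_combination hexRoot * hexRoot_pow_three

theorem hexRoot_pow_five : hexRoot ^ 5 = 1 - hexRoot := by
  linear_combination hexRoot ^ 2 * hexRoot_pow_three - hexRoot_sq

theorem hexRoot_linearIndependent {x y x' y' : ℤ}
    (h : (x : ℂ) + y * hexRoot = x' + y' * hexRoot) : x = x' ∧ y = y' := by
  have key : (((x - x') ^ 2 + (x - x') * (y - y') + (y - y') ^ 2 : ℤ) : ℂ) = 0 := by
    push_cast
    linear_combination ((x - x' : ℂ) + (y - y') - (y - y') * hexRoot) * h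
      + ((y - y') ^ 2 : ℂ) * hexRoot_sq
  rw [Int.cast_eq_zero] at key
  have h1 : x - x' = 0 := by nlinarith [sq_nonneg (x - x'), sq_nonneg ((x - x') + 2 * (y - y'))]
  have h2 : y - y' = 0 := by nlinarith [sq_nonneg (y - y'), sq_nonneg ((y - y') + 2 * (x - x'))]
  omega

/-- The multiset in which `u * hexRoot ^ k` has multiplicity `c k`. -/
def hex (u : ℂ) (c : Fin 6 → ℕ) : Multiset ℂ :=
  glue (fun k : Fin 6 => u * hexRoot ^ (k : ℕ)) (fun k => Multiset.replicate (c k) 1)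

theorem sum_hex (u : ℂ) (c : Fin 6 → ℕ) :
    (hex u c).sum = u * (((c 0 - c 2 - c 3 + c 5 : ℤ) : ℂ) +
      ((c 1 + c 2 - c 4 - c 5 : ℤ) : ℂ) * hexRoot) := by
  simp [hex, sum_glue, Fin.sum_univ_six, hexRoot_sq, hexRoot_pow_three, hexRoot_pow_four,
    hexRoot_pow_five]
  ring

theorem card_hex (u : ℂ) (c : Fin 6 → ℕ) :
    (hex u c).card = c 0 + c 1 + c 2 + c 3 + c 4 + c 5 := by
  simp [hex, card_glue, Fin.sum_univ_six]

theorem hex_mono {u : ℂ} {c d : Fin 6 → ℕ} (h : ∀ k, c k ≤ d k) : hex u c ≤ hex u d :=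
  glue_mono fun k => (Multiset.replicate_le_replicate 1).2 (h k)

theorem exists_hex {u : ℂ} (hu : u ^ 6 = 1) {T : Multiset ℂ} (hT : ∀ z ∈ T, z ^ 6 = 1) :
    ∃ c, T = hex u c := by
  have hu0 : u ≠ 0 := by
    rintro rfl
    simp at hu
  obtain ⟨A, hA, rfl⟩ := exists_glue (P := (· = 1)) (fun k : Fin 6 => u * hexRoot ^ (k : ℕ)) T (by
    intro z hz
    obtain ⟨i, hi, h⟩ := hexRoot_isPrimitiveRoot.eq_pow_of_pow_eq_one
      (ξ := z / u) (by rw [div_pow, hu, hT z hz, div_one])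
    refine ⟨⟨i, hi⟩, 1, rfl, ?_⟩
    simp only [h]
    field_simp)
  refine ⟨fun k => (A k).card, ?_⟩
  rw [hex]
  congr 1
  funext k
  exact Multiset.eq_replicate_card.2 (hA k)

theorem ZeroSumFree.hex_not_le {u : ℂ} {c : Fin 6 → ℕ} (h : ZeroSumFree (hex u c))
    (d : Fin 6 → ℕ) (h1 : (d 0 + d 5 : ℤ) = d 2 + d 3) (h2 : (d 1 + d 2 : ℤ) = d 4 + d 5)
    (h3 : d 0 + d 1 + d 2 + d 3 + d 4 + d 5 ≠ 0) : ¬ ∀ k, d k ≤ c k := by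
  intro hd
  have := h _ (hex_mono hd) (by
    rw [sum_hex, show (d 0 - d 2 - d 3 + d 5 : ℤ) = 0 by omega,
      show (d 1 + d 2 - d 4 - d 5 : ℤ) = 0 by omega]
    simp)
  exact h3 (by rw [← card_hex u, this, Multiset.card_zero])

theorem ZeroSumFree.hex_constraints {u : ℂ} {c : Fin 6 → ℕ} (h : ZeroSumFree (hex u c)) :
    (c 0 = 0 ∨ c 3 = 0) ∧ (c 1 = 0 ∨ c 4 = 0) ∧ (c 2 = 0 ∨ c 5 = 0) ∧
      (c 0 = 0 ∨ c 2 = 0 ∨ c 4 = 0) ∧ (c 1 = 0 ∨ c 3 = 0 ∨ c 5 = 0) := by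
  have h1 := h.hex_not_le ![1, 0, 0, 1, 0, 0] rfl rfl (by decide)
  have h2 := h.hex_not_le ![0, 1, 0, 0, 1, 0] rfl rfl (by decide)
  have h3 := h.hex_not_le ![0, 0, 1, 0, 0, 1] rfl rfl (by decide)
  have h4 := h.hex_not_le ![1, 0, 1, 0, 1, 0] rfl rfl (by decide)
  have h5 := h.hex_not_le ![0, 1, 0, 1, 0, 1] rfl rfl (by decide)
  simp [Fin.forall_fin_succ] at h1 h2 h3 h4 h5
  omega

theorem hex_unit (u : ℂ) : hex u ![1, 0, 0, 0, 0, 0] = {u} := by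
  simp [hex, glue, Fin.sum_univ_six]

theorem hex_pair (u : ℂ) :
    hex u ![0, 1, 0, 0, 0, 1] = {u * hexRoot} + {u * hexRoot ^ 5} := by
  simp [hex, glue, Fin.sum_univ_six]

theorem fin_six_funext {c : Fin 6 → ℕ} {a₀ a₁ a₂ a₃ a₄ a₅ : ℕ} (h₀ : c 0 = a₀) (h₁ : c 1 = a₁)
    (h₂ : c 2 = a₂) (h₃ : c 3 = a₃) (h₄ : c 4 = a₄) (h₅ : c 5 = a₅) :
    c = ![a₀, a₁, a₂, a₃, a₄, a₅] := by
  subst_vars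
  funext k
  fin_cases k <;> rfl

/-- The zero-sum-free multisets of sixth roots of unity whose sum is a root of unity. -/
theorem ZeroSumFree.eq_of_sixth_roots {u : ℂ} (hu : u ^ 6 = 1) {T : Multiset ℂ}
    (hT : ∀ z ∈ T, z ^ 6 = 1) (h : ZeroSumFree T) (hs : T.sum = u) :
    T = {u} ∨ T = {u * hexRoot} + {u * hexRoot ^ 5} := by
  have hu0 : u ≠ 0 := by
    rintro rfl
    simp at hu
  obtain ⟨c, rfl⟩ := exists_hex hu hT
  have hc := h.hex_constraints
  rw [sum_hex] at hs
  obtain ⟨h1, h2⟩ := hexRoot_linearIndependent (x' := 1) (y' := 0)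
    (mul_left_cancel₀ hu0 (hs.trans (by simp)))
  by_cases h0 : c 0 = 0
  · right
    rw [← hex_pair, ← fin_six_funext (c := c)] <;> omega
  · left
    rw [← hex_unit, ← fin_six_funext (c := c)] <;> omega

theorem zeroSumFree_singleton {z : ℂ} (hz : z ≠ 0) : ZeroSumFree {z} := by
  intro t ht h0
  rcases Multiset.le_singleton.1 ht with rfl | rfl
  · rfl
  · simp [hz] at h0

end hexagon

section singleton

theorem hexagon_arith {a₀ a₁ a₂ a₃ a₄ a₅ c₀ c₁ c₂ c₃ c₄ c₅ : ℕ}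
    (ha : (a₀ = 0 ∨ a₃ = 0) ∧ (a₁ = 0 ∨ a₄ = 0) ∧ (a₂ = 0 ∨ a₅ = 0) ∧
      (a₀ = 0 ∨ a₂ = 0 ∨ a₄ = 0) ∧ (a₁ = 0 ∨ a₃ = 0 ∨ a₅ = 0))
    (h₁ : (a₀ - a₂ - a₃ + a₅ : ℤ) = c₀ - c₂ - c₃ + c₅)
    (h₂ : (a₁ + a₂ - a₄ - a₅ : ℤ) = c₁ + c₂ - c₄ - c₅)
    (hcard : 2 ≤ a₀ + a₁ + a₂ + a₃ + a₄ + a₅) (hc₀ : c₀ ≠ 0)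
    (hc : c₀ + c₁ + c₂ + c₃ + c₄ + c₅ = 2) (hc₃ : c₀ = 0 ∨ c₃ = 0) :
    1 ≤ a₀ ∨ 1 ≤ a₁ ∧ 1 ≤ a₅ := by
  by_contra! h
  obtain rfl : a₀ = 0 := by omega
  obtain rfl : c₃ = 0 := by omega
  obtain ⟨-, h3, h4, -, h5⟩ := ha
  have h6 : a₁ = 0 ∨ a₅ = 0 := by omega
  have h7 : (c₁ + c₂ - c₄ - c₅ : ℤ) ≤ 1 := by omega
  have h8 : (c₀ - c₂ + c₅ : ℤ) ≥ 0 := by omega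
  clear h h5
  rcases h6 with rfl | rfl <;> rcases h3 with h3 | h3 <;> rcases h4 with h4 | h4 <;> subst_vars <;>
    omega

/-- A minimal zero-sum multiset of weight at most `12` all of whose five classes consist of
sixth roots of unity has a class with one element. -/
theorem MinimalZeroSum.exists_card_eq_one_of_five {A : ZMod 5 → Multiset ℂ} {α : ℂ}
    (h : MinimalZeroSum (cglue A)) (hA : ∀ j, ∀ η ∈ A j, η ^ 6 = 1) (hne : ∀ j, A j ≠ 0)
    (hα : ∀ j, (A j).sum = α) (hfree : ∀ j, ZeroSumFree (A j))
    (hcard : (cglue A).card ≤ 12) : ∃ j, (A j).card = 1 := by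
  by_contra! hone
  have htwo (j) : 2 ≤ (A j).card := by
    have := Multiset.card_pos.2 (hne j)
    have := hone j
    omega
  obtain ⟨i, hi⟩ : ∃ i, (A i).card ≤ 2 := by
    by_contra! h3
    rw [card_glue] at hcard
    have := Finset.sum_le_sum fun j (_ : j ∈ Finset.univ) => Nat.succ_le_of_lt (h3 j)
    simp [ZMod.card] at this
    omega
  obtain ⟨u, hu⟩ := Multiset.exists_mem_of_ne_zero (hne i)
  have hu6 := hA i u hu
  have hu0 : u ≠ 0 := by
    rintro rfl
    simp at hu6
  choose c hc using fun j => exists_hex hu6 (hA j)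
  have hcon (j) := (hc j ▸ hfree j).hex_constraints
  have hsum (j) := by
    have h1 := (hα j).trans (hα i).symm
    rw [hc j, hc i, sum_hex, sum_hex] at h1
    exact hexRoot_linearIndependent (mul_left_cancel₀ hu0 h1)
  have hcd (j) : (A j).card = _ := (congrArg Multiset.card (hc j)).trans (card_hex u (c j))
  have hci : c i 0 ≠ 0 := by
    intro h0
    rw [hc i] at hu
    obtain ⟨k, η, hη, hk⟩ := mem_glue.1 hu
    obtain ⟨hk0, rfl⟩ := Multiset.mem_replicate.1 hη
    rw [mul_one, mul_eq_left₀ hu0] at hk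
    have := hexRoot_isPrimitiveRoot.pow_inj k.2 (by norm_num) (hk.trans (pow_zero _).symm)
    exact hk0 (by rwa [show k = 0 from Fin.ext this])
  have hB (j) : ∃ B ≤ A j, B.sum = u := by
    rcases hexagon_arith (hcon j) (hsum j).1 (hsum j).2 (hcd j ▸ htwo j) hci
      (hcd i ▸ le_antisymm hi (htwo i)) (hcon i).1 with h1 | h1
    · refine ⟨hex u ![1, 0, 0, 0, 0, 0], ?_, by simp [hex_unit]⟩
      rw [hc j]
      refine hex_mono ?_
      simp [Fin.forall_fin_succ]
      omega
    · refine ⟨hex u ![0, 1, 0, 0, 0, 1], ?_, by simp [sum_hex]⟩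
      rw [hc j]
      refine hex_mono ?_
      simp [Fin.forall_fin_succ]
      omega
  choose B hB hBs using hB
  have hBA := h.eq_of_common_sum (sum_stdAddChar Nat.prime_five) hB hBs
    ⟨i, fun h0 => hu0 (by simpa [h0] using (hBs i).symm)⟩
  have h1 := hBs i
  rw [hBA, hc i, sum_hex] at h1
  obtain ⟨h2, h3⟩ := hexRoot_linearIndependent (x' := 1) (y' := 0)
    (mul_left_cancel₀ hu0 (h1.trans (by simp)))
  have := hcon i
  have := hcd i
  have := htwo i
  omega

end singleton

section counting

/-- The number of words of length `m` with letters of the listed costs and total cost at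
most `b`. -/
def wordCount (costs : List ℕ) : ℕ → ℕ → ℕ
  | 0, _ => 1
  | m + 1, b => (costs.map fun c => if c ≤ b then wordCount costs m (b - c) else 0).sum

theorem card_words_eq_wordCount {n : ℕ} (cost : Fin n → ℕ) (m b : ℕ) :
    Nat.card {w : Fin m → Fin n // ∑ j, cost (w j) ≤ b} = wordCount (List.ofFn cost) m b := by
  induction m generalizing b with
  | zero => simp [wordCount]
  | succ m ih =>
    rw [wordCount, List.map_ofFn, List.sum_ofFn]
    have e : {w : Fin (m + 1) → Fin n // ∑ j, cost (w j) ≤ b} ≃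
        Σ i : Fin n, {w : Fin m → Fin n // cost i + ∑ j, cost (w j) ≤ b} :=
      { toFun w := ⟨w.1 0, Fin.tail w.1, by
          have := w.2
          rwa [Fin.sum_univ_succ] at this⟩
        invFun w := ⟨Fin.cons w.1 w.2.1, by
          rw [Fin.sum_univ_succ]
          exact w.2.2⟩
        left_inv w := by simp
        right_inv w := rfl }
    rw [Nat.card_congr e, Nat.card_sigma]
    refine Finset.sum_congr rfl fun i _ => ?_
    rw [Function.comp_apply]
    split_ifs with h
    · rw [← ih]
      exact Nat.card_congr (Equiv.subtypeEquivRight fun w => by omega)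
    · have : IsEmpty {w : Fin m → Fin n // cost i + ∑ j, cost (w j) ≤ b} :=
        ⟨fun w => h (le_trans (Nat.le_add_right _ _) w.2)⟩
      exact Nat.card_of_isEmpty

end counting

/-- A family of zero-sum-free multisets of sum `1`, from which the minimal zero-sum multisets with
largest prime `p` are put together. -/
structure PieceSystem where
  /-- The prime number of pieces put together. -/
  p : ℕ
  [fact_prime : Fact p.Prime]
  /-- The pieces consist of `M`-th roots of unity. -/
  M : ℕ
  /-- The bound for the number of elements in excess of `p`. -/
  b : ℕ
  /-- The number of pieces. -/
  n : ℕ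
  /-- The pieces. -/
  piece : Fin n → Multiset ℂ
  pos : 0 < M
  coprime : p.Coprime M
  lt : b < p
  le_twelve : b + p ≤ 12
  pow_eq_one : ∀ i, ∀ η ∈ piece i, η ^ M = 1
  sum_eq_one : ∀ i, (piece i).sum = 1
  zeroSumFree : ∀ i, ZeroSumFree (piece i)
  injective : Function.Injective piece
  exists_one : ∃ i, piece i = {1}
  complete : ∀ T : Multiset ℂ, (∀ η ∈ T, η ^ M = 1) → T.sum = 1 → ZeroSumFree T →
    T.card + p ≤ 13 → ∃ i, piece i = T
  card_le : ∀ w : ZMod p → Fin n, (∃ j, (piece (w j)).card = 1) →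
    (cglue fun j => piece (w j)).card ≤ 12 → (cglue fun j => piece (w j)).card ≤ b + p
  exists_card_eq_one : ∀ (A : ZMod p → Multiset ℂ) (α : ℂ), MinimalZeroSum (cglue A) →
    (∀ j, ∀ η ∈ A j, η ^ M = 1) → (∀ j, A j ≠ 0) → (∀ j, (A j).sum = α) →
    (∀ j, ZeroSumFree (A j)) → (cglue A).card ≤ 12 → ∃ j, (A j).card = 1

namespace PieceSystem

variable (S : PieceSystem)

instance : Fact S.p.Prime := S.fact_prime

theorem prime : S.p.Prime := S.fact_prime.out

/-- A cyclic sequence of pieces. -/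
def Word : Type :=
  {w : ZMod S.p → Fin S.n // (cglue fun j => S.piece (w j)).card ≤ S.b + S.p}

variable {S}

/-- The classes of the multiset put together from a word. -/
def classes (w : S.Word) (j : ZMod S.p) : Multiset ℂ := S.piece (w.1 j)

/-- The multiset put together from a word. -/
def toMultiset (w : S.Word) : Multiset ℂ := cglue (classes w)

theorem pow_classes (w : S.Word) : ∀ j, ∀ η ∈ classes w j, η ^ S.M = 1 :=
  fun j => S.pow_eq_one (w.1 j)

theorem piece_ne_zero (i : Fin S.n) : S.piece i ≠ 0 := by
  intro h
  simpa [h] using S.sum_eq_one i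

theorem eq_singleton_of_card {i : Fin S.n} (h : (S.piece i).card = 1) : S.piece i = {1} := by
  obtain ⟨a, ha⟩ := Multiset.card_eq_one.1 h
  have := S.sum_eq_one i
  rw [ha, Multiset.sum_singleton] at this
  rw [ha, this]

theorem exists_classes_eq (w : S.Word) : ∃ j, classes w j = {1} := by
  by_contra! h
  have h2 (j) : 2 ≤ (classes w j).card := by
    have h0 := Multiset.card_pos.2 (piece_ne_zero (w.1 j))
    have h1 : (S.piece (w.1 j)).card ≠ 1 := fun h1 => h j (eq_singleton_of_card h1)
    change 2 ≤ (S.piece (w.1 j)).card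
    omega
  have h3 : (cglue (classes w)).card ≤ S.b + S.p := w.2
  rw [card_glue] at h3
  have h4 := Finset.sum_le_sum fun j (_ : j ∈ Finset.univ) => h2 j
  simp [ZMod.card] at h4
  have := S.lt
  omega

theorem minimalZeroSum_toMultiset (w : S.Word) : MinimalZeroSum (toMultiset w) := by
  refine ⟨?_, ?_, fun t ht h0 => ?_⟩
  · intro h
    have h1 := map_le_glue (R := fun j => ZMod.stdAddChar j) (A := classes w) 0
    rw [toMultiset, cglue] at h
    rw [h] at h1
    exact piece_ne_zero (w.1 0) (show classes w 0 = 0 by simpa using h1)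
  · rw [toMultiset, sum_glue, ← sum_stdAddChar S.prime]
    exact Finset.sum_congr rfl fun j _ => by rw [classes, S.sum_eq_one, mul_one]
  · obtain ⟨B, hB, rfl⟩ := exists_cglue S.coprime fun z hz =>
      pow_eq_one_of_mem_cglue (pow_classes w) (Multiset.mem_of_le ht hz)
    have hle := le_of_cglue_le S.coprime hB (pow_classes w) ht
    have hs := fun j => sum_eq_sum_of_cglue S.prime S.coprime S.pos hB h0 j
    obtain ⟨i, hi⟩ := exists_classes_eq w
    have := hle i
    rw [hi, Multiset.le_singleton] at this
    rcases this with h1 | h1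
    · left
      have hB0 : B = 0 := funext fun j => S.zeroSumFree _ _ (hle j) (by rw [hs j i, h1]; simp)
      simp [hB0, glue]
    · right
      have hBw : B = classes w := by
        funext j
        obtain ⟨u, hu⟩ := Multiset.le_iff_exists_add.1 (hle j)
        have hsum := congrArg Multiset.sum hu
        rw [classes, S.sum_eq_one, Multiset.sum_add, hs j i, h1, Multiset.sum_singleton,
          left_eq_add] at hsum
        have hu0 := S.zeroSumFree (w.1 j) u (by
          rw [classes] at hu
          rw [hu]
          exact Multiset.le_add_left _ _) hsum
        rw [hu, hu0, add_zero]
      rw [toMultiset, hBw]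

theorem pow_toMultiset (w : S.Word) : ∀ z ∈ toMultiset w, z ^ (S.p * S.M) = 1 :=
  fun _ => pow_eq_one_of_mem_cglue (pow_classes w)

theorem card_toMultiset_le (w : S.Word) : (toMultiset w).card ≤ 12 :=
  le_trans w.2 S.le_twelve

end PieceSystem

theorem map_mul_cglue {p : ℕ} [NeZero p] (A : ZMod p → Multiset ℂ) (k : ZMod p) (μ : ℂ) :
    (cglue A).map (ZMod.stdAddChar k * μ * ·) = cglue fun j => (A (j - k)).map (μ * ·) := by
  rw [map_mul_glue, cglue, glue, glue, ← Equiv.sum_comp (Equiv.subRight k)]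
  refine Finset.sum_congr rfl fun j _ => ?_
  rw [Equiv.subRight_apply, Multiset.map_map]
  refine Multiset.map_congr rfl fun η _ => ?_
  rw [Function.comp_apply, show ZMod.stdAddChar j =
    ZMod.stdAddChar k * ZMod.stdAddChar (j - k) by rw [← AddChar.map_add_eq_mul]; simp]
  ring

namespace PieceSystem

variable {S : PieceSystem}

theorem card_cglue_shift (w : ZMod S.p → Fin S.n) (g : ZMod S.p) :
    (cglue fun j => S.piece (w (j + g))).card = (cglue fun j => S.piece (w j)).card := by
  rw [card_glue, card_glue]
  exact Equiv.sum_comp (Equiv.addRight g) fun j => (S.piece (w j)).card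

instance : AddAction (ZMod S.p) S.Word where
  vadd g w := ⟨fun j => w.1 (j + g), by
    rw [card_cglue_shift]
    exact w.2⟩
  zero_vadd w := Subtype.ext (funext fun j => congrArg w.1 (add_zero j))
  add_vadd g h w := Subtype.ext (funext fun j => congrArg w.1 (by ring))

theorem vadd_apply (g : ZMod S.p) (w : S.Word) (j : ZMod S.p) : (g +ᵥ w).1 j = w.1 (j + g) := rfl

theorem toMultiset_vadd (g : ZMod S.p) (w : S.Word) :
    toMultiset (g +ᵥ w) = (toMultiset w).map (ZMod.stdAddChar (-g) * ·) := by
  have := map_mul_cglue (classes w) (-g) 1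
  simp only [mul_one, one_mul, sub_neg_eq_add, Multiset.map_id'] at this
  rw [toMultiset, toMultiset, this]
  rfl

theorem vadd_eq_of_map_eq {v w : S.Word} {c : ℂ} (h : (toMultiset w).map (c * ·) = toMultiset v) :
    ∃ g : ZMod S.p, g +ᵥ w = v := by
  have hc : c ^ (S.p * S.M) = 1 := by
    obtain ⟨z, hz⟩ := Multiset.exists_mem_of_ne_zero (minimalZeroSum_toMultiset w).1
    have h1 := pow_toMultiset v (c * z) (h ▸ Multiset.mem_map_of_mem _ hz)
    rwa [mul_pow, pow_toMultiset w z hz, mul_one] at h1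
  obtain ⟨k, μ, hμ, rfl⟩ := exists_stdAddChar_mul S.coprime hc
  rw [toMultiset, map_mul_cglue] at h
  have h1 := eq_of_cglue_eq S.coprime (by
    intro j z hz
    obtain ⟨η, hη, rfl⟩ := Multiset.mem_map.1 hz
    rw [mul_pow, hμ, pow_classes w _ η hη, one_mul]) (pow_classes v) h
  have hμ1 : μ = 1 := by
    have h2 := congrArg Multiset.sum (congrFun h1 0)
    rwa [sum_map_mul, classes, classes, S.sum_eq_one, S.sum_eq_one, mul_one] at h2
  refine ⟨-k, Subtype.ext (funext fun j => S.injective ?_)⟩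
  have h2 := congrFun h1 j
  simp only [hμ1, one_mul, Multiset.map_id'] at h2
  rw [vadd_apply, ← sub_eq_add_neg]
  exact h2

instance : Finite S.Word := Subtype.finite

/-- A word fixed by a nontrivial shift is constant, hence consists of singletons. -/
theorem card_fixedBy {g : ZMod S.p} (hg : g ≠ 0) :
    Nat.card (AddAction.fixedBy S.Word g) = 1 := by
  obtain ⟨i, hi⟩ := S.exists_one
  have hw : (cglue fun _ : ZMod S.p => S.piece i).card ≤ S.b + S.p := by
    rw [card_glue]
    simp [hi, ZMod.card]
  rw [Nat.card_eq_one_iff_unique]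
  refine ⟨⟨fun v w => ?_⟩, ⟨⟨⟨fun _ => i, hw⟩, rfl⟩⟩⟩
  have key (v : AddAction.fixedBy S.Word g) (j : ZMod S.p) : v.1.1 j = i := by
    have h1 (j) : v.1.1 (j + g) = v.1.1 j := congrFun (congrArg Subtype.val v.2) j
    have h2 (m : ℕ) (j) : v.1.1 (j + m * g) = v.1.1 j := by
      induction m with
      | zero => simp
      | succ m ih => rw [← ih, ← h1 (j + m * g), Nat.cast_succ, add_mul, one_mul, add_assoc]
    obtain ⟨k, hk⟩ := exists_classes_eq v.1
    have h3 := h2 ((k - j) / g).val j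
    rw [ZMod.natCast_zmod_val, div_mul_cancel₀ _ hg, add_sub_cancel] at h3
    rw [← h3]
    exact S.injective (hk.trans hi.symm)
  exact Subtype.ext (Subtype.ext (funext fun j => (key v j).trans (key w j).symm))

theorem card_orbits_mul :
    Nat.card (Quotient (AddAction.orbitRel (ZMod S.p) S.Word)) * S.p
      = Nat.card S.Word + (S.p - 1) := by
  classical
  have := Fintype.ofFinite S.Word
  have := Fintype.ofFinite (Quotient (AddAction.orbitRel (ZMod S.p) S.Word))
  have h := AddAction.sum_card_fixedBy_eq_card_orbits_mul_card_addGroup (ZMod S.p) S.Word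
  rw [ZMod.card, ← Nat.card_eq_fintype_card] at h
  rw [← h, ← Finset.add_sum_erase _ _ (Finset.mem_univ 0)]
  congr 1
  · rw [← Nat.card_eq_fintype_card]
    refine Nat.card_congr ⟨fun w => w.1, fun w => ⟨w, zero_vadd _ w⟩, fun _ => rfl, fun _ => rfl⟩
  · rw [Finset.sum_congr rfl fun g hg => by
      rw [← Nat.card_eq_fintype_card, card_fixedBy (Finset.ne_of_mem_erase hg)]]
    simp [Finset.card_erase_of_mem, ZMod.card]

theorem card_word :
    Nat.card S.Word = wordCount (List.ofFn fun i => (S.piece i).card - 1) S.p S.b := by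
  rw [← card_words_eq_wordCount]
  refine Nat.card_congr (Equiv.subtypeEquiv (Equiv.arrowCongr
    (Fintype.equivFinOfCardEq (ZMod.card S.p)) (Equiv.refl _)) fun w => ?_)
  rw [card_glue]
  simp only [Equiv.arrowCongr_apply, Function.comp_apply, Equiv.coe_refl, id]
  rw [Equiv.sum_comp (Fintype.equivFinOfCardEq (ZMod.card S.p)).symm
    fun j => (S.piece (w j)).card - 1]
  have : ∑ j, (S.piece (w j)).card = ∑ j, ((S.piece (w j)).card - 1) + S.p := by
    have h1 : ∀ j, (S.piece (w j)).card = ((S.piece (w j)).card - 1) + 1 := fun j =>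
      (Nat.sub_add_cancel (Multiset.card_pos.2 (piece_ne_zero _))).symm
    rw [Finset.sum_congr rfl fun j _ => h1 j, Finset.sum_add_distrib]
    simp [ZMod.card]
  omega

end PieceSystem

section simplex

theorem eq_replicate_of_sq_eq_one {T : Multiset ℂ} {u : ℂ} (hu : u ∈ T)
    (hT : ∀ η ∈ T, η ^ 2 = 1) (h : ZeroSumFree T) : T = Multiset.replicate T.card u := by
  rw [Multiset.eq_replicate_card]
  intro z hz
  by_contra hzu
  have h1 : z = -u := by
    have h2 := hT z hz
    rw [← hT u hu, sq_eq_sq_iff_eq_or_eq_neg] at h2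
    exact h2.resolve_left hzu
  obtain ⟨T, rfl⟩ := Multiset.exists_cons_of_mem hu
  have h2 : z ∈ T := (Multiset.mem_cons.1 hz).resolve_left hzu
  obtain ⟨T, rfl⟩ := Multiset.exists_cons_of_mem h2
  have h3 := h (u ::ₘ {z}) (Multiset.cons_le_cons _ (by
    rw [← Multiset.cons_zero]
    exact Multiset.cons_le_cons _ (Multiset.zero_le _))) (by simp [h1])
  simp at h3

theorem eq_singleton_of_sq_eq_one {T : Multiset ℂ} (hT : ∀ η ∈ T, η ^ 2 = 1)
    (h : ZeroSumFree T) (hs : T.sum = 1) : T = {1} := by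
  obtain ⟨u, hu⟩ := Multiset.exists_mem_of_ne_zero (s := T) (by rintro rfl; simp at hs)
  have h1 := eq_replicate_of_sq_eq_one hu hT h
  have hu2 := hT u hu
  rw [h1, Multiset.sum_replicate, nsmul_eq_mul] at hs
  rcases sq_eq_sq_iff_eq_or_eq_neg.1 (hu2.trans (one_pow 2).symm) with rfl | rfl
  · rw [mul_one, Nat.cast_eq_one] at hs
    rw [h1, hs, Multiset.replicate_one]
  · exfalso
    have : (T.card : ℂ) + 1 = 0 := by linear_combination -hs
    exact Nat.cast_add_one_ne_zero _ this

theorem exists_card_eq_one_of_sq_eq_one {p : ℕ} [NeZero p] (hp : p.Prime)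
    {A : ZMod p → Multiset ℂ} {α : ℂ} (h : MinimalZeroSum (cglue A))
    (hA : ∀ j, ∀ η ∈ A j, η ^ 2 = 1) (hne : ∀ j, A j ≠ 0) (hα : ∀ j, (A j).sum = α)
    (hfree : ∀ j, ZeroSumFree (A j)) : ∃ j, (A j).card = 1 := by
  choose u hu using fun j => Multiset.exists_mem_of_ne_zero (hne j)
  have hrep (j) := eq_replicate_of_sq_eq_one (hu j) (hA j) (hfree j)
  have hu0 : u 0 ≠ 0 := by
    intro h0
    have := hA 0 _ (hu 0)
    simp [h0] at this
  have huj (j) : u j = u 0 := by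
    have h1 := hA j _ (hu j)
    rw [← hA 0 _ (hu 0), sq_eq_sq_iff_eq_or_eq_neg] at h1
    refine h1.resolve_right fun h2 => ?_
    have h3 := (hα j).trans (hα 0).symm
    rw [hrep j, hrep 0, Multiset.sum_replicate, Multiset.sum_replicate, h2, nsmul_eq_mul,
      nsmul_eq_mul] at h3
    have h4 : (((A j).card + (A 0).card : ℕ) : ℂ) * u 0 = 0 := by
      push_cast
      linear_combination -h3
    have h5 := Nat.cast_eq_zero.1 ((mul_eq_zero.1 h4).resolve_right hu0)
    exact hne 0 (Multiset.card_eq_zero.1 (by omega))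
  have hBA := h.eq_of_common_sum (B := fun _ => {u 0}) (sum_stdAddChar hp)
    (fun j => Multiset.singleton_le.2 (huj j ▸ hu j))
    (fun _ => Multiset.sum_singleton _) ⟨0, by simp⟩
  exact ⟨0, by rw [← hBA, Multiset.card_singleton]⟩

/-- The only minimal zero-sum multiset with largest prime `2` or `3` is that of all `p`-th roots
of unity. -/
def simplexSystem (p M : ℕ) [hp : Fact p.Prime] (hM : M ∣ 2) (hpM : p.Coprime M)
    (hp12 : p ≤ 12) : PieceSystem where
  p := p
  M := M
  b := 0
  n := 1
  piece _ := {1}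
  pos := Nat.pos_of_dvd_of_pos hM two_pos
  coprime := hpM
  lt := hp.out.pos
  le_twelve := by simpa using hp12
  pow_eq_one := by simp
  sum_eq_one := by simp
  zeroSumFree _ := zeroSumFree_singleton one_ne_zero
  injective := Function.injective_of_subsingleton _
  exists_one := ⟨0, rfl⟩
  complete T hT hs hfree _ := ⟨0, by
    obtain ⟨q, hq⟩ := hM
    exact (eq_singleton_of_sq_eq_one (fun η hη => by rw [hq, pow_mul, hT η hη, one_pow])
      hfree hs).symm⟩
  card_le w _ _ := by
    rw [card_glue]
    simp [ZMod.card]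
  exists_card_eq_one A α h hA hne hα hfree _ := by
    obtain ⟨q, hq⟩ := hM
    exact exists_card_eq_one_of_sq_eq_one hp.out h
      (fun j η hη => by rw [hq, pow_mul, hA j η hη, one_pow]) hne hα hfree

end simplex

section pair

theorem zeroSumFree_pair {a b : ℂ} (ha : a ≠ 0) (hb : b ≠ 0) (hab : a + b ≠ 0) :
    ZeroSumFree ({a} + {b}) := by
  intro t ht h0
  rw [Multiset.singleton_add, ← Multiset.mem_powerset, Multiset.powerset_cons,
    ← Multiset.cons_zero, Multiset.powerset_cons] at ht
  simp at ht
  rcases ht with rfl | rfl | rfl | rfl <;> simp_all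

theorem hexRoot_ne_zero : hexRoot ≠ 0 := hexRoot_isPrimitiveRoot.ne_zero (by norm_num)

theorem hexRoot_pow_six : hexRoot ^ 6 = 1 := hexRoot_isPrimitiveRoot.pow_eq_one

/-- The pieces `1` and `-ω - ω²`, where `ω` is a primitive third root of unity. -/
def pairPiece : Fin 2 → Multiset ℂ := ![{1}, {hexRoot} + {hexRoot ^ 5}]

theorem pow_pairPiece {M : ℕ} (hM : 6 ∣ M) (i) : ∀ η ∈ pairPiece i, η ^ M = 1 := by
  obtain ⟨q, rfl⟩ := hM
  have : (hexRoot ^ 5) ^ 6 = 1 := by rw [← pow_mul, mul_comm, pow_mul, hexRoot_pow_six, one_pow]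
  fin_cases i <;> simp [pairPiece, pow_mul, hexRoot_pow_six, this]

theorem sum_pairPiece (i) : (pairPiece i).sum = 1 := by
  fin_cases i <;> simp [pairPiece, hexRoot_pow_five]

theorem zeroSumFree_pairPiece (i) : ZeroSumFree (pairPiece i) := by
  fin_cases i
  · exact zeroSumFree_singleton one_ne_zero
  · exact zeroSumFree_pair hexRoot_ne_zero (pow_ne_zero _ hexRoot_ne_zero)
      (by simp [hexRoot_pow_five])

theorem pairPiece_injective : Function.Injective pairPiece := by
  intro i j h
  have := congrArg Multiset.card h
  fin_cases i <;> fin_cases j <;> simp [pairPiece] at this ⊢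

theorem card_pairPiece_le (i) : (pairPiece i).card ≤ 2 := by
  fin_cases i <;> simp [pairPiece]

/-- The pieces for the prime `5`. -/
def pentagonSystem : PieceSystem where
  p := 5
  M := 6
  b := 4
  n := 2
  fact_prime := ⟨Nat.prime_five⟩
  piece := pairPiece
  pos := by norm_num
  coprime := by norm_num
  lt := by norm_num
  le_twelve := by norm_num
  pow_eq_one := pow_pairPiece dvd_rfl
  sum_eq_one := sum_pairPiece
  zeroSumFree := zeroSumFree_pairPiece
  injective := pairPiece_injective
  exists_one := ⟨0, rfl⟩
  complete T hT hs hfree _ := by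
    rcases hfree.eq_of_sixth_roots (one_pow 6) hT hs with rfl | rfl
    · exact ⟨0, rfl⟩
    · exact ⟨1, by simp [pairPiece]⟩
  card_le := by
    rintro w ⟨j, hj⟩ -
    rw [card_glue, ← Finset.add_sum_erase _ _ (Finset.mem_univ j), hj]
    have := Finset.sum_le_sum fun i (_ : i ∈ Finset.univ.erase j) => card_pairPiece_le (w i)
    simp [Finset.card_erase_of_mem, ZMod.card] at this
    omega
  exists_card_eq_one A α h hA hne hα hfree hcard :=
    h.exists_card_eq_one_of_five hA hne hα hfree hcard

theorem exists_card_eq_one_of_card_lt {p : ℕ} [NeZero p] {A : ZMod p → Multiset ℂ}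
    (hne : ∀ j, A j ≠ 0) (hcard : (cglue A).card < 2 * p) : ∃ j, (A j).card = 1 := by
  by_contra! hone
  have htwo (j) : 2 ≤ (A j).card := by
    have := Multiset.card_pos.2 (hne j)
    have := hone j
    omega
  rw [card_glue] at hcard
  have := Finset.sum_le_sum fun j (_ : j ∈ Finset.univ) => htwo j
  simp [ZMod.card] at this
  omega

theorem eq_hexRoot_of_add_eq_one {a b : ℂ} {M : ℕ} (hM : M ≠ 0) (ha : a ^ M = 1)
    (hb : b ^ M = 1) (hab : a + b = 1) : a = hexRoot ∨ a = hexRoot ^ 5 := by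
  have ha0 : a ≠ 0 := by
    rintro rfl
    simp [hM] at ha
  have hb0 : b ≠ 0 := by
    rintro rfl
    simp [hM] at hb
  have h1 := congrArg (starRingEnd ℂ) hab
  rw [map_add, map_one, ← Complex.inv_eq_conj (Complex.norm_eq_one_of_pow_eq_one ha hM),
    ← Complex.inv_eq_conj (Complex.norm_eq_one_of_pow_eq_one hb hM)] at h1
  field_simp at h1
  have h2 : (a - hexRoot) * (a - hexRoot ^ 5) = 0 := by
    rw [hexRoot_pow_five]
    linear_combination a * hab + h1 - hab - hexRoot_sq
  simpa [sub_eq_zero] using h2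

/-- The pieces for the prime `11`. -/
def hendecagonSystem : PieceSystem where
  p := 11
  M := 210
  b := 1
  n := 2
  fact_prime := ⟨Nat.prime_eleven⟩
  piece := pairPiece
  pos := by norm_num
  coprime := by norm_num
  lt := by norm_num
  le_twelve := by norm_num
  pow_eq_one := pow_pairPiece (by norm_num)
  sum_eq_one := sum_pairPiece
  zeroSumFree := zeroSumFree_pairPiece
  injective := pairPiece_injective
  exists_one := ⟨0, rfl⟩
  complete T hT hs hfree hcard := by
    obtain h | h | h : T.card = 0 ∨ T.card = 1 ∨ T.card = 2 := by omega
    · rw [Multiset.card_eq_zero] at h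
      simp [h] at hs
    · obtain ⟨a, rfl⟩ := Multiset.card_eq_one.1 h
      rw [Multiset.sum_singleton] at hs
      exact ⟨0, by rw [hs]; rfl⟩
    · obtain ⟨a, b, rfl⟩ := Multiset.card_eq_two.1 h
      have hab : a + b = 1 := by simpa using hs
      refine ⟨1, ?_⟩
      rcases eq_hexRoot_of_add_eq_one (by norm_num) (hT a (by simp)) (hT b (by simp)) hab
        with rfl | rfl
      · rw [show b = hexRoot ^ 5 by rw [hexRoot_pow_five]; linear_combination hab]
        rfl
      · rw [show b = hexRoot by rw [hexRoot_pow_five] at hab; linear_combination hab,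
          Multiset.pair_comm]
        rfl
  card_le _ _ h := h
  exists_card_eq_one A _ _ _ hne _ _ hcard :=
    exists_card_eq_one_of_card_lt hne (by omega)

end pair

section thirty

/-- An enumeration of the thirtieth roots of unity by the numbers below `30`. -/
def thirtyRoot (n : ℕ) : ℂ := ZMod.stdAddChar ((n / 6 : ℕ) : ZMod 5) * hexRoot ^ (n % 6)

/-- The coordinates of a sixth root of unity in the basis `1`, `hexRoot`. -/
def hexCoord (n : ℕ) : ℤ × ℤ :=
  [(1, 0), (0, 1), (-1, 1), (-1, 0), (0, -1), (1, -1)].getD (n % 6) 0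

/-- The coordinates of the coefficient of the `j`-th fifth root of unity in a sum of
thirtieth roots of unity. -/
def thirtyCoord (L : List ℕ) (j : ℕ) : ℤ × ℤ :=
  ((L.filter fun n => n / 6 % 5 = j).map hexCoord).sum

/-- Whether the sum of a list of thirtieth roots of unity vanishes. -/
def IsBalanced (L : List ℕ) : Prop := ∀ j : Fin 5, thirtyCoord L j = thirtyCoord L 0

instance (L : List ℕ) : Decidable (IsBalanced L) :=
  inferInstanceAs (Decidable (∀ j : Fin 5, thirtyCoord L j = thirtyCoord L 0))

theorem hexRoot_pow_mod (n : ℕ) :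
    hexRoot ^ (n % 6) = ((hexCoord n).1 : ℂ) + (hexCoord n).2 * hexRoot := by
  have : n % 6 < 6 := Nat.mod_lt _ (by norm_num)
  unfold hexCoord
  interval_cases n % 6 <;>
    simp [hexRoot_sq, hexRoot_pow_three, hexRoot_pow_four, hexRoot_pow_five] <;> ring

theorem sum_hexRoot_pow (L : List ℕ) : (L.map fun n => hexRoot ^ (n % 6)).sum =
    (((L.map hexCoord).sum.1 : ℤ) : ℂ) + ((L.map hexCoord).sum.2 : ℤ) * hexRoot := by
  induction L with
  | nil => simp
  | cons n L ih =>
    simp only [List.map_cons, List.sum_cons, ih, hexRoot_pow_mod n, Prod.fst_add, Prod.snd_add]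
    push_cast
    ring

/-- The class of the `j`-th fifth root of unity in a list of thirtieth roots of unity. -/
def thirtyClass (L : List ℕ) (j : ZMod 5) : Multiset ℂ :=
  ((L.filter fun n => n / 6 % 5 = j.val).map fun n => hexRoot ^ (n % 6) : List ℂ)

theorem cglue_thirtyClass (L : List ℕ) :
    (L.map thirtyRoot : Multiset ℂ) = cglue (thirtyClass L) := by
  induction L with
  | nil => simp [thirtyClass, glue]
  | cons n L ih =>
    have : thirtyClass (n :: L) =
        Pi.single ((n / 6 : ℕ) : ZMod 5) {hexRoot ^ (n % 6)} + thirtyClass L := by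
      funext j
      rw [Pi.add_apply, Pi.single_apply]
      have hj : j = ((n / 6 : ℕ) : ZMod 5) ↔ n / 6 % 5 = j.val := by
        rw [← ZMod.val_natCast, (ZMod.val_injective 5).eq_iff, eq_comm]
      simp only [hj, thirtyClass, List.filter_cons, decide_eq_true_eq]
      split_ifs <;> simp
    rw [this, cglue, glue_add, glue_single, ← cglue, ← ih]
    rfl

theorem hexRoot_pow_pow_six (k : ℕ) : (hexRoot ^ k) ^ 6 = 1 := by
  rw [← pow_mul, mul_comm, pow_mul, hexRoot_pow_six, one_pow]

theorem pow_thirtyClass (L : List ℕ) : ∀ j, ∀ η ∈ thirtyClass L j, η ^ 6 = 1 := by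
  intro j η hη
  simp only [thirtyClass, Multiset.mem_coe, List.mem_map] at hη
  obtain ⟨n, -, rfl⟩ := hη
  exact hexRoot_pow_pow_six _

theorem sum_thirtyClass (L : List ℕ) (j : ZMod 5) : (thirtyClass L j).sum =
    ((thirtyCoord L j.val).1 : ℂ) + (thirtyCoord L j.val).2 * hexRoot := by
  rw [thirtyClass, Multiset.sum_coe, sum_hexRoot_pow, thirtyCoord]

theorem sum_thirtyRoot_eq_zero_iff (L : List ℕ) : (L.map thirtyRoot).sum = 0 ↔ IsBalanced L := by
  rw [← Multiset.sum_coe, cglue_thirtyClass]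
  constructor
  · intro h j
    have := sum_eq_sum_of_cglue Nat.prime_five (by norm_num) (by norm_num) (pow_thirtyClass L) h
      (show ZMod 5 from j) 0
    rw [sum_thirtyClass, sum_thirtyClass] at this
    exact Prod.ext_iff.2 (hexRoot_linearIndependent this)
  · intro h
    have h1 (j : ZMod 5) : (thirtyClass L j).sum = (thirtyClass L 0).sum := by
      rw [sum_thirtyClass, sum_thirtyClass, show thirtyCoord L j.val = _ from h j]
      rfl
    rw [cglue, sum_glue]
    simp only [h1, ← Finset.sum_mul, sum_stdAddChar Nat.prime_five, zero_mul]

theorem thirtyRoot_injOn : Set.InjOn thirtyRoot {n | n < 30} := by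
  intro m hm n hn h
  simp only [Set.mem_ofPred_eq] at hm hn
  obtain ⟨h1, h2⟩ := stdAddChar_mul_inj (p := 5) (M := 6) (by norm_num) (hexRoot_pow_pow_six _)
    (hexRoot_pow_pow_six _) h
  have h3 := hexRoot_isPrimitiveRoot.pow_inj (Nat.mod_lt _ (by norm_num))
    (Nat.mod_lt _ (by norm_num)) h2
  have h4 := congrArg ZMod.val h1
  rw [ZMod.val_natCast, ZMod.val_natCast] at h4
  omega

theorem perm_of_map_thirtyRoot {L L' : List ℕ} (hL : ∀ n ∈ L, n < 30) (hL' : ∀ n ∈ L', n < 30)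
    (h : (L.map thirtyRoot).Perm (L'.map thirtyRoot)) : L.Perm L' := by
  have h1 := h.map (Function.invFunOn thirtyRoot {n | n < 30})
  have key (L : List ℕ) (hL : ∀ n ∈ L, n < 30) :
      (L.map thirtyRoot).map (Function.invFunOn thirtyRoot {n | n < 30}) = L := by
    rw [List.map_map]
    conv_rhs => rw [← List.map_id L]
    exact List.map_congr_left fun n hn => thirtyRoot_injOn.leftInvOn_invFunOn (hL n hn)
  rwa [key L hL, key L' hL'] at h1

theorem thirtyRoot_three : thirtyRoot 3 = -1 := by simp [thirtyRoot, hexRoot_pow_three]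

theorem thirtyRoot_pow (n : ℕ) : thirtyRoot n ^ 30 = 1 := by
  rw [thirtyRoot, mul_pow, show 30 = 5 * 6 from rfl, pow_mul, stdAddChar_pow_self, mul_comm 5 6,
    pow_mul (hexRoot ^ _), hexRoot_pow_pow_six, one_pow, one_pow, one_mul]

theorem zeroSumFree_map_thirtyRoot {L : List ℕ} (h : ∀ l ∈ L.sublists', IsBalanced l → l = []) :
    ZeroSumFree (L.map thirtyRoot : List ℂ) := by
  intro t ht h0
  induction t using Quotient.inductionOn with | h t => ?_
  obtain ⟨l, hl, hsub⟩ := (Multiset.coe_le.1 ht)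
  obtain ⟨l', hl', rfl⟩ := List.sublist_map_iff.1 hsub
  rw [Multiset.quot_mk_to_coe, ← Multiset.coe_eq_coe.2 hl] at h0 ⊢
  rw [Multiset.sum_coe, sum_thirtyRoot_eq_zero_iff] at h0
  rw [h l' (List.mem_sublists'.2 hl') h0]
  rfl

theorem sum_map_thirtyRoot {L : List ℕ} (h : IsBalanced (3 :: L)) :
    (L.map thirtyRoot).sum = 1 := by
  rw [← sum_thirtyRoot_eq_zero_iff, List.map_cons, List.sum_cons, thirtyRoot_three] at h
  linear_combination h

end thirty

section heptagon

/-- The pieces for the prime `7`, as lists of exponents of thirtieth roots of unity. -/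
def heptagonList (i : Fin 23) : List ℕ :=
  [[0], [1, 5], [9, 15, 21, 27], [1, 8, 14, 20, 26], [5, 10, 16, 22, 28], [8, 10, 15, 21, 27],
    [9, 14, 16, 21, 27], [9, 15, 20, 22, 27], [9, 15, 21, 26, 28], [1, 7, 9, 14, 20, 26],
    [1, 8, 13, 15, 20, 26], [1, 8, 14, 19, 21, 26], [1, 8, 14, 20, 25, 27],
    [5, 9, 11, 16, 22, 28], [5, 10, 15, 17, 22, 28], [5, 10, 16, 21, 23, 28],
    [5, 10, 16, 22, 27, 29], [8, 10, 14, 16, 21, 27], [8, 10, 15, 20, 22, 27],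
    [8, 10, 15, 21, 26, 28], [9, 14, 16, 20, 22, 27], [9, 14, 16, 21, 26, 28],
    [9, 15, 20, 22, 26, 28]].getD i []

/-- The pieces for the prime `7`. -/
def heptagonPiece (i : Fin 23) : Multiset ℂ := ((heptagonList i).map thirtyRoot : List ℂ)

theorem heptagonList_lt (i : Fin 23) : ∀ n ∈ heptagonList i, n < 30 := by
  revert i
  decide +kernel

theorem heptagonPiece_injective : Function.Injective heptagonPiece := by
  intro i j h
  have h1 := perm_of_map_thirtyRoot (heptagonList_lt i) (heptagonList_lt j)
    (Multiset.coe_eq_coe.1 h)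
  rw [← List.isPerm_iff] at h1
  revert i j
  have : ∀ i j : Fin 23, (heptagonList i).isPerm (heptagonList j) = true → i = j := by
    decide +kernel
  exact fun i j _ h => this i j h

/-- Five classes of sixth roots of unity with the same sum `hexRoot ^ k`. -/
def pentagonClass (k : ℕ) (v : Bool) : List ℕ :=
  if v then [(k + 1) % 6, (k + 5) % 6] else [k % 6]

/-- The union of five classes. -/
def pentagonList (k : ℕ) (v₀ v₁ v₂ v₃ v₄ : Bool) : List ℕ :=
  pentagonClass k v₀ ++ ((pentagonClass k v₁).map (6 + ·) ++ ((pentagonClass k v₂).map (12 + ·) ++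
    ((pentagonClass k v₃).map (18 + ·) ++ (pentagonClass k v₄).map (24 + ·))))

theorem pentagonList_lt : ∀ (k : Fin 6) (v₀ v₁ v₂ v₃ v₄ : Bool),
    ∀ n ∈ pentagonList k v₀ v₁ v₂ v₃ v₄, n < 30 := by
  decide +kernel

theorem exists_isPerm_erase : ∀ (k : Fin 6) (v₀ v₁ v₂ v₃ v₄ : Bool),
    3 ∈ pentagonList k v₀ v₁ v₂ v₃ v₄ → (pentagonList k v₀ v₁ v₂ v₃ v₄).length ≤ 7 →
    ∃ i : Fin 23,
      (heptagonList i).isPerm ((pentagonList k v₀ v₁ v₂ v₃ v₄).erase 3) = true := by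
  decide +kernel

theorem hexRoot_pow_mod_six (n : ℕ) : hexRoot ^ (n % 6) = hexRoot ^ n := by
  conv_rhs => rw [← Nat.mod_add_div n 6, pow_add, pow_mul, hexRoot_pow_six, one_pow, mul_one]

theorem map_pentagonClass (k : ℕ) (v : Bool) (j : ℕ) :
    (((pentagonClass k v).map (6 * j + ·)).map thirtyRoot : List ℂ) =
      ((pentagonClass k v).map (hexRoot ^ ·)).map (ZMod.stdAddChar (j : ZMod 5) * ·) := by
  have h (n : ℕ) : (6 * j + n % 6) / 6 = j := by omega
  have h' (n : ℕ) : (6 * j + n % 6) % 6 = n % 6 := by omega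
  cases v <;> simp [pentagonClass, thirtyRoot, h, h']

theorem cglue_pentagonClass (k : ℕ) (v : ZMod 5 → Bool) :
    cglue (fun j : ZMod 5 => ((pentagonClass k (v j)).map (hexRoot ^ ·) : Multiset ℂ)) =
      ((pentagonList k (v 0) (v 1) (v 2) (v 3) (v 4)).map thirtyRoot : List ℂ) := by
  have h (j : ZMod 5) (i : ℕ) (hi : (i : ZMod 5) = j) :
      Multiset.map (ZMod.stdAddChar j * ·) ((pentagonClass k (v j)).map (hexRoot ^ ·) : List ℂ) =
      ((pentagonClass k (v j)).map (6 * i + ·)).map thirtyRoot := by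
    rw [map_pentagonClass, hi]
    rfl
  rw [cglue, glue]
  change ∑ j : Fin 5, _ = _
  rw [Fin.sum_univ_five, pentagonList]
  erw [h 0 0 rfl, h 1 1 rfl, h 2 2 rfl, h 3 3 rfl, h 4 4 rfl]
  simp only [List.map_append, ← Multiset.coe_add, add_assoc]
  simp

theorem exists_heptagonPiece {T : Multiset ℂ} (hT : ∀ η ∈ T, η ^ 30 = 1) (hs : T.sum = 1)
    (h : ZeroSumFree T) (hcard : T.card + 7 ≤ 13) : ∃ i, heptagonPiece i = T := by
  have hmin := h.minimalZeroSum_cons hs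
  have hT' : ∀ z ∈ (-1 : ℂ) ::ₘ T, z ^ (5 * 6) = 1 := by
    simpa [Multiset.mem_cons, Even.neg_one_pow (show Even 30 by decide)] using hT
  rcases hmin.reduce_of_coprime Nat.prime_five (by norm_num) (by norm_num) hT' with
    ⟨j, hj⟩ | ⟨A, α, hA, hA6, hα0, hα, hfree⟩
  · have hj1 : ZMod.stdAddChar j = (1 : ℂ) := by
      have h1 := hj (-1) (Multiset.mem_cons_self _ _)
      rw [mul_pow, stdAddChar_pow, Even.neg_one_pow (show Even 6 by decide), mul_one] at h1
      rwa [show ((6 : ℕ) : ZMod 5) = 1 from rfl, one_mul] at h1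
    rw [hj1] at hj
    rcases h.eq_of_sixth_roots (one_pow 6)
      (fun z hz => by simpa using hj z (Multiset.mem_cons_of_mem hz)) hs with rfl | rfl
    · exact ⟨0, by simp [heptagonPiece, heptagonList, thirtyRoot]⟩
    · exact ⟨1, by
        simp [heptagonPiece, heptagonList, thirtyRoot]
        rfl⟩
  · have hc := congrArg Multiset.card hA
    rw [Multiset.card_cons] at hc
    have hne (j) : A j ≠ 0 := by
      intro h0
      exact hα0 (by rw [← hα j, h0, Multiset.sum_zero])
    obtain ⟨i, hi⟩ := exists_card_eq_one_of_card_lt hne (by omega)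
    obtain ⟨u, hu⟩ := Multiset.card_eq_one.1 hi
    obtain rfl : u = α := by rw [← hα i, hu, Multiset.sum_singleton]
    have hu6 : u ^ 6 = 1 := hA6 i u (by simp [hu])
    obtain ⟨k, hk, rfl⟩ := hexRoot_isPrimitiveRoot.eq_pow_of_pow_eq_one hu6
    have hv (j) : ∃ v : Bool, A j = ((pentagonClass k v).map (hexRoot ^ ·) : List ℂ) := by
      rcases (hfree j).eq_of_sixth_roots hu6 (hA6 j) (hα j) with h1 | h1
      · exact ⟨false, by simp [h1, pentagonClass, hexRoot_pow_mod_six]⟩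
      · exact ⟨true, by
          simp [h1, pentagonClass, hexRoot_pow_mod_six, pow_add]
          rfl⟩
    choose v hv using hv
    obtain rfl := funext hv
    rw [cglue_pentagonClass] at hA
    set L := pentagonList k (v 0) (v 1) (v 2) (v 3) (v 4) with hL
    have hlt : ∀ n ∈ L, n < 30 := pentagonList_lt ⟨k, hk⟩ _ _ _ _ _
    have h3 : 3 ∈ L := by
      have : (-1 : ℂ) ∈ (L.map thirtyRoot : Multiset ℂ) := hA ▸ Multiset.mem_cons_self _ _
      simp only [Multiset.mem_coe, List.mem_map] at this
      obtain ⟨n, hn, hn1⟩ := this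
      rwa [← thirtyRoot_injOn (hlt n hn) (by norm_num) (hn1.trans thirtyRoot_three.symm)]
    have hlen : L.length ≤ 7 := by
      have := congrArg Multiset.card hA
      simp at this
      omega
    obtain ⟨i, hi⟩ := exists_isPerm_erase ⟨k, hk⟩ _ _ _ _ _ h3 hlen
    refine ⟨i, ?_⟩
    rw [heptagonPiece, Multiset.coe_eq_coe.2 ((List.isPerm_iff.1 hi).map _)]
    rw [Multiset.coe_eq_coe.2 ((List.perm_cons_erase h3).map thirtyRoot), List.map_cons,
      ← Multiset.cons_coe, thirtyRoot_three, Multiset.cons_inj_right] at hA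
    exact hA.symm

/-- The pieces for the prime `7`. -/
def heptagonSystem : PieceSystem where
  p := 7
  M := 30
  b := 5
  n := 23
  fact_prime := ⟨Nat.prime_seven⟩
  piece := heptagonPiece
  pos := by norm_num
  coprime := by norm_num
  lt := by norm_num
  le_twelve := by norm_num
  pow_eq_one i η hη := by
    obtain ⟨n, -, rfl⟩ := List.mem_map.1 (Multiset.mem_coe.1 hη)
    exact thirtyRoot_pow n
  sum_eq_one i := sum_map_thirtyRoot (by
    revert i
    decide +kernel)
  zeroSumFree i := zeroSumFree_map_thirtyRoot (by
    revert i
    decide +kernel)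
  injective := heptagonPiece_injective
  exists_one := ⟨0, by simp [heptagonPiece, heptagonList, thirtyRoot]⟩
  complete _ hT hs h hcard := exists_heptagonPiece hT hs h hcard
  card_le _ _ h := h
  exists_card_eq_one A _ _ _ hne _ _ hcard := exists_card_eq_one_of_card_lt hne (by omega)

end heptagon

namespace PieceSystem

theorem exists_word (S : PieceSystem) {A : ZMod S.p → Multiset ℂ} {α : ℂ}
    (h : MinimalZeroSum (cglue A)) (hA : ∀ j, ∀ η ∈ A j, η ^ S.M = 1) (hα0 : α ≠ 0)
    (hα : ∀ j, (A j).sum = α) (hfree : ∀ j, ZeroSumFree (A j)) (hcard : (cglue A).card ≤ 12) :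
    ∃ u : ℂ, u ^ S.M = 1 ∧ ∃ w : S.Word, (cglue A).map (u * ·) = toMultiset w := by
  have hne (j) : A j ≠ 0 := by
    intro h0
    exact hα0 (by rw [← hα j, h0, Multiset.sum_zero])
  obtain ⟨i, hi⟩ := S.exists_card_eq_one A α h hA hne hα hfree hcard
  have hαM : α ^ S.M = 1 := by
    obtain ⟨u, hu⟩ := Multiset.card_eq_one.1 hi
    rw [← hα i, hu, Multiset.sum_singleton]
    exact hA i u (by simp [hu])
  have hcj (j) : (A j).card + S.p ≤ 13 := by
    rw [card_glue, ← Finset.add_sum_erase _ _ (Finset.mem_univ j)] at hcard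
    have := Finset.sum_le_sum fun k (_ : k ∈ Finset.univ.erase j) =>
      Nat.succ_le_of_lt (Multiset.card_pos.2 (hne k))
    simp [Finset.card_erase_of_mem, ZMod.card] at this
    omega
  have hw (j) : ∃ k, S.piece k = (A j).map (α⁻¹ * ·) := by
    refine S.complete _ ?_ ?_ ((hfree j).map_mul (inv_ne_zero hα0)) ?_
    · intro z hz
      obtain ⟨η, hη, rfl⟩ := Multiset.mem_map.1 hz
      rw [mul_pow, inv_pow, hαM, hA j η hη, inv_one, one_mul]
    · rw [sum_map_mul, hα, inv_mul_cancel₀ hα0]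
    · rw [Multiset.card_map]
      exact hcj j
  choose w hw using hw
  have hwA : (cglue A).map (α⁻¹ * ·) = cglue fun j => S.piece (w j) := by
    rw [map_mul_glue']
    simp only [hw]
  refine ⟨α⁻¹, by rw [inv_pow, hαM, inv_one], ⟨w, S.card_le w ⟨i, ?_⟩ ?_⟩, hwA⟩
  · rw [hw, Multiset.card_map, hi]
  · rwa [← hwA, Multiset.card_map]

theorem map_toMultiset_ne {S S' : PieceSystem} (hdvd : S.p * S.M ∣ S'.M) (w : S.Word)
    (w' : S'.Word) (c : ℂ) : (toMultiset w').map (c * ·) ≠ toMultiset w := by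
  intro h
  have key (j : ZMod S'.p) : (c * ZMod.stdAddChar j) ^ S'.M = 1 := by
    obtain ⟨η, hη⟩ := Multiset.exists_mem_of_ne_zero (piece_ne_zero (w'.1 j))
    obtain ⟨q, hq⟩ := hdvd
    have h1 := pow_toMultiset w (c * (ZMod.stdAddChar j * η))
      (h ▸ Multiset.mem_map_of_mem _ (mem_glue.2 ⟨j, η, hη, rfl⟩))
    have h2 : (c * (ZMod.stdAddChar j * η)) ^ S'.M = 1 := by rw [hq, pow_mul, h1, one_pow]
    rwa [← mul_assoc, mul_pow, S'.pow_eq_one _ η hη, mul_one] at h2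
  have h0 := key 0
  rw [AddChar.map_zero_eq_one, mul_one] at h0
  have h1 := key 1
  rw [mul_pow, h0, one_mul] at h1
  have := (stdAddChar_mul_inj S'.coprime (i := 1) (j := 0) (one_pow _) h1 (by simp)).1
  exact one_ne_zero this

theorem card_orbits_eq {S : PieceSystem} {k : ℕ} (h : Nat.card S.Word + (S.p - 1) = k * S.p) :
    Nat.card (Quotient (AddAction.orbitRel (ZMod S.p) S.Word)) = k :=
  Nat.eq_of_mul_eq_mul_right S.prime.pos (card_orbits_mul.trans h)

end PieceSystem

open PieceSystem

/-- The systems of pieces for the primes up to `12`. -/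
def primeSystem : Fin 5 → PieceSystem :=
  ![simplexSystem 2 1 (by norm_num) (by norm_num) (by norm_num),
    simplexSystem 3 2 (by norm_num) (by norm_num) (by norm_num),
    pentagonSystem, heptagonSystem, hendecagonSystem]

theorem primeSystem_p (i : Fin 5) : (primeSystem i).p = ![2, 3, 5, 7, 11] i := by
  fin_cases i <;> rfl

theorem primeSystem_M (i : Fin 5) : (primeSystem i).M = ![1, 2, 6, 30, 210] i := by
  fin_cases i <;> rfl

theorem primeSystem_dvd {i j : Fin 5} (h : i < j) :
    (primeSystem i).p * (primeSystem i).M ∣ (primeSystem j).M := by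
  rw [primeSystem_p, primeSystem_M, primeSystem_M]
  revert i j
  decide

theorem exists_primeSystem {p M : ℕ} (hp : p.Prime) (hp12 : p ≤ 12) (hM : Squarefree M)
    (h : ∀ q, q.Prime → q ∣ M → q < p) : ∃ i, (primeSystem i).p = p ∧ M ∣ (primeSystem i).M := by
  obtain ⟨i, hi, hq⟩ : ∃ i : Fin 5, ![2, 3, 5, 7, 11] i = p ∧
      ∀ q < p, q.Prime → q ∣ ![1, 2, 6, 30, 210] i := by
    clear h
    interval_cases p
    all_goals first
      | exact ⟨0, rfl, by decide⟩
      | exact ⟨1, rfl, by decide⟩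
      | exact ⟨2, rfl, by decide⟩
      | exact ⟨3, rfl, by decide⟩
      | exact ⟨4, rfl, by decide⟩
      | exact absurd hp (by decide)
  refine ⟨i, by rw [primeSystem_p, hi], ?_⟩
  rw [primeSystem_M, ← Nat.prod_primeFactors_of_squarefree hM]
  refine Finset.prod_primes_dvd _ (fun q hqM => (Nat.prime_of_mem_primeFactors hqM).prime)
    fun q hqM => ?_
  have hqp := Nat.prime_of_mem_primeFactors hqM
  exact hq q (h q hqp (Nat.dvd_of_mem_primeFactors hqM)) hqp

theorem MinimalZeroSum.exists_word {N : ℕ} (hN : 0 < N) {s : Multiset ℂ} (h : MinimalZeroSum s)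
    (hs : ∀ z ∈ s, z ^ N = 1) (hcard : s.card ≤ 12) :
    ∃ c : ℂ, (∃ m : ℕ, 0 < m ∧ c ^ m = 1) ∧
      ∃ (i : Fin 5) (w : (primeSystem i).Word), s.map (c * ·) = toMultiset w := by
  induction N using Nat.strong_induction_on generalizing s with
  | _ N ih =>
  by_cases H : ∃ p M : ℕ, p.Prime ∧ N = p * M ∧
      ∃ c : ℂ, c ^ N = 1 ∧ ∀ z ∈ s, (c * z) ^ M = 1
  · obtain ⟨p, M, hp, rfl, c, hc, hcs⟩ := H
    have hM := Nat.pos_of_mul_pos_left hN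
    have hc0 : c ≠ 0 := by
      rintro rfl
      simp [hN.ne'] at hc
    obtain ⟨d, ⟨m, hm, hd⟩, i, w, hw⟩ := ih M (lt_mul_left hM hp.one_lt) hM (h.map_mul hc0)
      (by simpa using hcs) (by simpa using hcard)
    refine ⟨d * c, ⟨m * (p * M), Nat.mul_pos hm hN, ?_⟩, i, w, ?_⟩
    · rw [mul_pow, pow_mul, hd, mul_comm m, pow_mul c, hc, one_pow, one_pow, one_mul]
    · rw [← hw, Multiset.map_map]
      simp only [Function.comp_def, mul_assoc]
  have hprime {p M : ℕ} (hp : p.Prime) (hNM : N = p * M) : p.Coprime M ∧ p ≤ 12 ∧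
      ∃ (_ : NeZero p) (A : ZMod p → Multiset ℂ) (α : ℂ), s = cglue A ∧
        (∀ j, ∀ η ∈ A j, η ^ M = 1) ∧ α ≠ 0 ∧ (∀ j, (A j).sum = α) ∧
        (∀ j, ZeroSumFree (A j)) := by
    subst hNM
    have hM := Nat.pos_of_mul_pos_left hN
    have hpM : p.Coprime M := by
      rw [hp.coprime_iff_not_dvd]
      exact fun hpM => H ⟨p, M, hp, rfl, h.reduce_of_dvd hp hM hpM hs⟩
    have hp0 : NeZero p := ⟨hp.ne_zero⟩
    rcases h.reduce_of_coprime hp hM hpM hs with ⟨j, hj⟩ | ⟨A, α, hA, hAM, hα0, hα, hfree⟩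
    · exact absurd ⟨p, M, hp, rfl, _, by rw [pow_mul, stdAddChar_pow_self, one_pow], hj⟩ H
    · refine ⟨hpM, ?_, hp0, A, α, hA, hAM, hα0, hα, hfree⟩
      rw [hA, card_glue] at hcard
      have hne (j) : 1 ≤ (A j).card := by
        refine Multiset.card_pos.2 fun h0 => hα0 ?_
        rw [← hα j, h0, Multiset.sum_zero]
      have := Finset.sum_le_sum fun j (_ : j ∈ Finset.univ) => hne j
      simp [ZMod.card] at this
      omega
  have hN1 : N ≠ 1 := by
    rintro rfl
    have h1 : s = Multiset.replicate s.card 1 := Multiset.eq_replicate_card.2 (by simpa using hs)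
    have h2 := h.2.1
    rw [h1, Multiset.sum_replicate] at h2
    simp [h.1] at h2
  obtain ⟨p, hp, hmax⟩ := Finset.exists_max_image N.primeFactors id
    (Nat.nonempty_primeFactors.2 (by omega))
  have hpp := Nat.prime_of_mem_primeFactors hp
  obtain ⟨M, rfl⟩ := Nat.dvd_of_mem_primeFactors hp
  obtain ⟨hpM, hp12, hp0, A, α, rfl, hAM, hα0, hα, hfree⟩ := hprime hpp rfl
  have hsq : Squarefree M := by
    rw [Nat.squarefree_iff_prime_squarefree]
    rintro q hq ⟨r, hr⟩
    have := (hprime hq (M := p * (q * r)) (by rw [hr]; ring)).1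
    rw [hq.coprime_iff_not_dvd] at this
    exact this ⟨p * r, by ring⟩
  obtain ⟨i, rfl, t, ht⟩ := exists_primeSystem hpp hp12 hsq fun q hq hqM => by
    refine lt_of_le_of_ne (hmax q ?_) ?_
    · exact Nat.mem_primeFactors.2 ⟨hq, Dvd.dvd.mul_left hqM _, hN.ne'⟩
    · rintro rfl
      exact (hq.coprime_iff_not_dvd.1 hpM) hqM
  obtain ⟨u, hu, w, hw⟩ := (primeSystem i).exists_word h
    (fun j η hη => by rw [ht, pow_mul, hAM j η hη, one_pow]) hα0 hα hfree hcard
  exact ⟨u, ⟨_, (primeSystem i).pos, hu⟩, i, w, hw⟩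

theorem card_orbits_primeSystem (i : Fin 5) :
    Nat.card (Quotient (AddAction.orbitRel (ZMod (primeSystem i).p) (primeSystem i).Word)) =
      ![1, 1, 7, 96, 2] i := by
  apply card_orbits_eq
  rw [card_word]
  fin_cases i
  · simp [primeSystem, simplexSystem, wordCount]
  · simp [primeSystem, simplexSystem, wordCount]
  · change wordCount (List.ofFn fun i => (pairPiece i).card - 1) 5 4 + 4 = 7 * 5
    simp only [List.ofFn_succ, List.ofFn_zero]
    change wordCount [0, 1] 5 4 + 4 = 7 * 5
    decide +kernel
  · change wordCount (List.ofFn fun i => (heptagonPiece i).card - 1) 7 5 + 6 = 96 * 7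
    have : (fun i => (heptagonPiece i).card - 1) = fun i => (heptagonList i).length - 1 := by
      funext i
      simp [heptagonPiece]
    rw [this]
    decide +kernel
  · change wordCount (List.ofFn fun i => (pairPiece i).card - 1) 11 1 + 10 = 2 * 11
    simp only [List.ofFn_succ, List.ofFn_zero]
    change wordCount [0, 1] 11 1 + 10 = 2 * 11
    decide +kernel

namespace ZeroRelation

/-- The roots of unity in a relation, counted with multiplicity. -/
def toMultiset (a : ZeroRelation) : Multiset ℂ := Finsupp.toMultiset a.coeff

theorem sum_toMultiset (f : ℂ →₀ ℕ) :
    (Finsupp.toMultiset f).sum = f.sum fun z c => (c : ℂ) * z := by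
  simp [Finsupp.sum_toMultiset, nsmul_eq_mul]

theorem card_toMultiset (a : ZeroRelation) : a.toMultiset.card = a.weight :=
  Finsupp.card_toMultiset a.coeff

theorem exists_pow_eq_one (a : ZeroRelation) :
    ∃ N, 0 < N ∧ ∀ z ∈ a.toMultiset, z ^ N = 1 := by
  choose! m hm using a.mem_rootsOfUnity
  refine ⟨∏ z ∈ a.coeff.support, m z, Finset.prod_pos fun z hz => (hm z hz).1, fun z hz => ?_⟩
  rw [toMultiset, Finsupp.mem_toMultiset] at hz
  obtain ⟨q, hq⟩ := Finset.dvd_prod_of_mem m hz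
  rw [hq, pow_mul, (hm z hz).2, one_pow]

theorem IsMinimal.minimalZeroSum {a : ZeroRelation} (ha : a.IsMinimal) :
    MinimalZeroSum a.toMultiset := by
  classical
  refine ⟨fun h => a.ne_zero ?_, (sum_toMultiset a.coeff).trans a.sum_zero, fun t ht h0 => ?_⟩
  · rwa [toMultiset, Finsupp.toMultiset_eq_iff, Multiset.toFinsupp_zero] at h
  · rw [← Multiset.toFinsupp_toMultiset t] at ht h0 ⊢
    rw [sum_toMultiset] at h0
    rcases ha _ (fun z => Finsupp.orderIsoMultiset.le_iff_le.1 ht z) h0 with h | h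
    · left
      rw [h, Finsupp.toMultiset_zero]
    · right
      rw [h, toMultiset]

/-- The relation given by a multiset of roots of unity with sum zero. -/
def ofMultiset (s : Multiset ℂ) (h : MinimalZeroSum s)
    (hs : ∀ z ∈ s, ∃ m : ℕ, 0 < m ∧ z ^ m = 1) : ZeroRelation where
  coeff := Multiset.toFinsupp s
  mem_rootsOfUnity z hz := hs z (by
    rwa [← Finsupp.mem_toMultiset, Multiset.toFinsupp_toMultiset] at hz)
  ne_zero h0 := h.1 (by simpa using h0)
  sum_zero := by rw [← sum_toMultiset, Multiset.toFinsupp_toMultiset, h.2.1]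

theorem toMultiset_ofMultiset {s : Multiset ℂ} (h : MinimalZeroSum s)
    (hs : ∀ z ∈ s, ∃ m : ℕ, 0 < m ∧ z ^ m = 1) : (ofMultiset s h hs).toMultiset = s :=
  Multiset.toFinsupp_toMultiset s

theorem isMinimal_ofMultiset {s : Multiset ℂ} (h : MinimalZeroSum s)
    (hs : ∀ z ∈ s, ∃ m : ℕ, 0 < m ∧ z ^ m = 1) : (ofMultiset s h hs).IsMinimal := by
  intro b hb h0
  rw [← sum_toMultiset] at h0
  have hle : Finsupp.toMultiset b ≤ s := by
    rw [← toMultiset_ofMultiset h hs]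
    exact Finsupp.orderIsoMultiset.monotone hb
  rcases h.2.2 _ hle h0 with h1 | h1
  · left
    rwa [Finsupp.toMultiset_eq_iff, Multiset.toFinsupp_zero] at h1
  · right
    rwa [Finsupp.toMultiset_eq_iff] at h1

theorem isRotation_iff {a b : ZeroRelation} : a.IsRotation b ↔
    ∃ c : ℂ, (∃ m : ℕ, 0 < m ∧ c ^ m = 1) ∧ a.toMultiset.map (c * ·) = b.toMultiset := by
  classical
  simp only [IsRotation, toMultiset, Finsupp.toMultiset_map]
  exact exists_congr fun c => and_congr_right fun _ =>
    (Finsupp.orderIsoMultiset (ι := ℂ)).injective.eq_iff.symm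

theorem isRotation_equivalence : Equivalence IsRotation where
  refl a := isRotation_iff.2 ⟨1, ⟨1, one_pos, one_pow 1⟩, by simp⟩
  symm {a b} h := by
    rw [isRotation_iff] at h ⊢
    obtain ⟨c, ⟨m, hm, hc⟩, h⟩ := h
    have hc0 : c ≠ 0 := by
      rintro rfl
      simp [hm.ne'] at hc
    exact ⟨c⁻¹, ⟨m, hm, by rw [inv_pow, hc, inv_one]⟩,
      by rw [← h, map_mul_map_mul (inv_mul_cancel₀ hc0)]⟩
  trans {a b d} h h' := by
    rw [isRotation_iff] at h h' ⊢
    obtain ⟨c, ⟨m, hm, hc⟩, h⟩ := h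
    obtain ⟨c', ⟨m', hm', hc'⟩, h'⟩ := h'
    refine ⟨c' * c, ⟨m * m', Nat.mul_pos hm hm', ?_⟩, ?_⟩
    · rw [mul_pow, pow_mul c, hc, mul_comm m, pow_mul, hc', one_pow, one_pow, one_mul]
    · rw [← h', ← h, Multiset.map_map]
      simp only [Function.comp_def, mul_assoc]

/-- The minimal relation given by a word. -/
def ofWord {S : PieceSystem} (w : S.Word) : {r : ZeroRelation // r.IsMinimal ∧ r.weight ≤ 12} :=
  ⟨ofMultiset (PieceSystem.toMultiset w) (minimalZeroSum_toMultiset w)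
      fun z hz => ⟨_, Nat.mul_pos S.prime.pos S.pos, pow_toMultiset w z hz⟩,
    isMinimal_ofMultiset _ _, by
      rw [← card_toMultiset, toMultiset_ofMultiset]
      exact card_toMultiset_le w⟩

theorem isRotation_ofWord_iff {S S' : PieceSystem} (w : S.Word) (w' : S'.Word) :
    (ofWord w).1.IsRotation (ofWord w').1 ↔ ∃ c : ℂ, (∃ m : ℕ, 0 < m ∧ c ^ m = 1) ∧
      (PieceSystem.toMultiset w).map (c * ·) = PieceSystem.toMultiset w' := by
  rw [isRotation_iff, ofWord, ofWord, toMultiset_ofMultiset, toMultiset_ofMultiset]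

theorem isRotation_vadd {S : PieceSystem} (g : ZMod S.p) (w : S.Word) :
    (ofWord w).1.IsRotation (ofWord (g +ᵥ w)).1 :=
  (isRotation_ofWord_iff _ _).2 ⟨_, ⟨S.p, S.prime.pos, stdAddChar_pow_self _⟩,
    (toMultiset_vadd g w).symm⟩

/-- The class up to rotation of the minimal relation given by a word up to shift. -/
def ofOrbit (x : Σ i, Quotient (AddAction.orbitRel (ZMod (primeSystem i).p) (primeSystem i).Word)) :
    Quot (fun a b : {r : ZeroRelation // r.IsMinimal ∧ r.weight ≤ 12} => a.1.IsRotation b.1) :=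
  Quotient.lift (fun w => Quot.mk _ (ofWord w)) (by
    intro v w hvw
    obtain ⟨g, rfl⟩ := AddAction.mem_orbit_iff.1 (AddAction.orbitRel_apply.1 hvw)
    refine (Quot.sound ?_).symm
    exact isRotation_vadd g w) x.2

theorem ofOrbit_injective : Function.Injective ofOrbit := by
  rintro ⟨i, v⟩ ⟨j, w⟩ h
  induction v using Quotient.inductionOn with | h v => ?_
  induction w using Quotient.inductionOn with | h w => ?_
  have hequiv : Equivalence fun a b : {r : ZeroRelation // r.IsMinimal ∧ r.weight ≤ 12} =>
      a.1.IsRotation b.1 :=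
    isRotation_equivalence.comap Subtype.val
  have h1 := hequiv.eqvGen_iff.1 (Quot.eqvGen_exact h)
  rcases lt_trichotomy i j with hij | rfl | hij
  · obtain ⟨c, -, hc⟩ := (isRotation_ofWord_iff _ _).1 (isRotation_equivalence.symm h1)
    exact absurd hc (map_toMultiset_ne (primeSystem_dvd hij) v w c)
  · obtain ⟨c, -, hc⟩ := (isRotation_ofWord_iff _ _).1 (isRotation_equivalence.symm h1)
    exact congrArg (Sigma.mk i) (Quotient.sound (AddAction.orbitRel_apply.2
      (AddAction.mem_orbit_iff.2 (vadd_eq_of_map_eq hc))))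
  · obtain ⟨c, -, hc⟩ := (isRotation_ofWord_iff _ _).1 h1
    exact absurd hc (map_toMultiset_ne (primeSystem_dvd hij) w v c)

theorem ofOrbit_surjective : Function.Surjective ofOrbit := by
  rintro ⟨a, ha, hcard⟩
  obtain ⟨N, hN, hs⟩ := a.exists_pow_eq_one
  obtain ⟨c, hc, i, w, hw⟩ := ha.minimalZeroSum.exists_word hN hs (a.card_toMultiset ▸ hcard)
  refine ⟨⟨i, Quotient.mk _ w⟩, (Quot.sound ?_).symm⟩
  refine isRotation_iff.2 ⟨c, hc, ?_⟩
  rw [hw, ofWord, toMultiset_ofMultiset]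

end ZeroRelation

/-- Up to rotation, there are exactly 107 minimal relations of weight at most 12. -/
theorem card_minimal_relations_weight_le_twelve :
    Nat.card (Quot (fun a b : {r : ZeroRelation // r.IsMinimal ∧ r.weight ≤ 12} =>
      a.1.IsRotation b.1)) = 107 := by
  rw [← Nat.card_eq_of_bijective _ ⟨ZeroRelation.ofOrbit_injective,
    ZeroRelation.ofOrbit_surjective⟩, Nat.card_sigma, Finset.sum_congr rfl fun i _ =>
    card_orbits_primeSystem i]
  rfl
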